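/- arXiv:0901.4324 — 2 statements merged into one kernel-verified Lean document; each statement's English description precedes it below -/
import Mathlib

section
/- Let f be continuously differentiable, satisfying (P), (KO) and condition (1.5), and let u be a large solution of Δu = f(u) in the open unit ball B of ℝ^N. Then u is radially symmetric: there exists w : [0,1) → ℝ with u(x) = w(‖x‖) for all x ∈ B. Moreover ∂u/∂r > 0 in B \ {0}: for every x ∈ B with x ≠ 0, the directional derivative of u at x in the direction x/‖x‖ is strictly positive. -/
open MeasureTheory Filter Metric Set

/-- The Laplacian of `u : ℝ^N → ℝ` at a point, as the sum of the second
derivatives in the coordinate directions. -/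
noncomputable def lapl {N : ℕ} (u : EuclideanSpace ℝ (Fin N) → ℝ)
    (x : EuclideanSpace ℝ (Fin N)) : ℝ :=
  ∑ i : Fin N, iteratedFDeriv ℝ 2 u x ![EuclideanSpace.single i 1, EuclideanSpace.single i 1]

/-- A large solution of Δu = f(u) on the open unit ball of ℝ^N. -/
def IsLargeSolution {N : ℕ} (f : ℝ → ℝ) (u : EuclideanSpace ℝ (Fin N) → ℝ) : Prop :=
  ContDiffOn ℝ 2 u (ball 0 1) ∧
  (∀ x ∈ ball (0 : EuclideanSpace ℝ (Fin N)) 1, lapl u x = f (u x)) ∧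
  ∀ x₀ ∈ sphere (0 : EuclideanSpace ℝ (Fin N)) 1,
    Tendsto u (nhdsWithin x₀ (ball 0 1)) atTop

open scoped Topology Laplacian

section LaplacianCalculus

lemma deriv_deriv_line {E : Type*} [NormedAddCommGroup E] [NormedSpace ℝ E] {z : E → ℝ} {x : E}
    (hz : ContDiffAt ℝ 2 z x) (v : E) :
    deriv (deriv fun s : ℝ => z (x + s • v)) 0 = iteratedFDeriv ℝ 2 z x ![v, v] := by
  have hline : ∀ s : ℝ, HasDerivAt (fun s : ℝ => x + s • v) v s := fun s => by
    simpa using ((hasDerivAt_id s).smul_const v).const_add x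
  have hcont : Tendsto (fun s : ℝ => x + s • v) (𝓝 0) (𝓝 x) := by
    have := (hline 0).continuousAt.tendsto
    simpa using this
  have h1 : (deriv fun s : ℝ => z (x + s • v)) =ᶠ[𝓝 0] fun s => fderiv ℝ z (x + s • v) v := by
    have hev : ∀ᶠ y in 𝓝 x, DifferentiableAt ℝ z y :=
      (hz.eventually (by simp)).mono fun y hy => hy.differentiableAt (by simp)
    filter_upwards [hcont.eventually hev] with s hs
    exact (hs.hasFDerivAt.comp_hasDerivAt s (hline s)).deriv
  rw [h1.deriv_eq, iteratedFDeriv_two_apply]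
  have h2 : DifferentiableAt ℝ (fderiv ℝ z) x :=
    (hz.fderiv_right (m := 1) (by norm_num)).differentiableAt (by simp)
  have h2' : HasFDerivAt (fderiv ℝ z) (fderiv ℝ (fderiv ℝ z) x) (x + (0 : ℝ) • v) := by
    simpa using h2.hasFDerivAt
  have h3 := h2'.comp_hasDerivAt (0 : ℝ) (hline 0)
  have h4 := h3.clm_apply (hasDerivAt_const (0 : ℝ) v)
  simpa using h4.deriv

lemma deriv_deriv_nonneg_of_isLocalMin {g : ℝ → ℝ} {s : ℝ} (h : IsLocalMin g s)
    (hc : ContinuousAt g s) : 0 ≤ deriv (deriv g) s := by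
  by_contra! hneg
  have hmax := isLocalMax_of_deriv_deriv_neg hneg h.deriv_eq_zero hc
  have hconst : g =ᶠ[𝓝 s] fun _ => g s := by
    filter_upwards [h, hmax] with y h1 h2 using le_antisymm h2 h1
  have h1 : deriv g =ᶠ[𝓝 s] fun _ => 0 := by
    have := hconst.deriv
    simpa using this
  have h2 := h1.deriv_eq
  simp only [deriv_const] at h2
  linarith

variable {N : ℕ}

local notation "𝔼" => EuclideanSpace ℝ (Fin N)

lemma lapl_eq_laplacian (u : 𝔼 → ℝ) : lapl u = Δ u := by
  rw [InnerProductSpace.laplacian_eq_iteratedFDeriv_orthonormalBasis u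
    (EuclideanSpace.basisFun (Fin N) ℝ)]
  ext x
  simp [lapl]

lemma lapl_add {u v : 𝔼 → ℝ} {x : 𝔼} (hu : ContDiffAt ℝ 2 u x) (hv : ContDiffAt ℝ 2 v x) :
    lapl (fun y => u y + v y) x = lapl u x + lapl v x := by
  simp only [lapl_eq_laplacian]
  exact hu.laplacian_add hv

lemma lapl_sub {u v : 𝔼 → ℝ} {x : 𝔼} (hu : ContDiffAt ℝ 2 u x) (hv : ContDiffAt ℝ 2 v x) :
    lapl (fun y => u y - v y) x = lapl u x - lapl v x := by
  simp only [lapl_eq_laplacian]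
  exact hu.laplacian_sub hv

lemma lapl_const_mul {u : 𝔼 → ℝ} {x : 𝔼} (c : ℝ) (hu : ContDiffAt ℝ 2 u x) :
    lapl (fun y => c * u y) x = c * lapl u x := by
  simp only [lapl_eq_laplacian]
  exact InnerProductSpace.laplacian_smul c hu

lemma lapl_nonneg_of_isLocalMin {z : 𝔼 → ℝ} {x : 𝔼} (hz : ContDiffAt ℝ 2 z x)
    (h : IsLocalMin z x) : 0 ≤ lapl z x := by
  refine Finset.sum_nonneg fun i _ => ?_
  rw [← deriv_deriv_line hz]
  have hline : Continuous fun s : ℝ => x + s • (EuclideanSpace.single i (1 : ℝ) : 𝔼) := by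
    fun_prop
  have h0 : x + (0 : ℝ) • (EuclideanSpace.single i (1 : ℝ) : 𝔼) = x := by simp
  refine deriv_deriv_nonneg_of_isLocalMin ?_ ?_
  · have := hline.tendsto 0
    rw [h0] at this
    filter_upwards [this.eventually h] with s hs
    simpa [h0] using hs
  · have hz' : ContinuousAt z (x + (0 : ℝ) • (EuclideanSpace.single i (1 : ℝ) : 𝔼)) := by
      rw [h0]; exact hz.continuousAt
    exact ContinuousAt.comp (f := fun s : ℝ => x + s • (EuclideanSpace.single i (1 : ℝ) : 𝔼))
      hz' hline.continuousAt

lemma deriv_deriv_comp_poly {G G1 : ℝ → ℝ} {G2 A B C : ℝ}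
    (h1 : ∀ᶠ s in 𝓝 A, HasDerivAt G (G1 s) s) (h2 : HasDerivAt G1 G2 A) :
    deriv (deriv fun s : ℝ => G (A + B * s + C * s ^ 2)) 0 = B ^ 2 * G2 + 2 * C * G1 A := by
  have hp : ∀ s : ℝ, HasDerivAt (fun s : ℝ => A + B * s + C * s ^ 2) (B + 2 * C * s) s := by
    intro s
    have := (((hasDerivAt_id s).const_mul B).const_add A).add
      (((hasDerivAt_id s).pow 2).const_mul C)
    refine this.congr_deriv ?_
    simp; ring
  have hcont : Tendsto (fun s : ℝ => A + B * s + C * s ^ 2) (𝓝 0) (𝓝 A) := by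
    simpa using (hp 0).continuousAt.tendsto
  have h3 : (deriv fun s : ℝ => G (A + B * s + C * s ^ 2)) =ᶠ[𝓝 0]
      fun s => G1 (A + B * s + C * s ^ 2) * (B + 2 * C * s) := by
    filter_upwards [hcont.eventually h1] with s hs
    exact (hs.comp s (hp s)).deriv
  rw [h3.deriv_eq]
  have h2' : HasDerivAt G1 G2 (A + B * 0 + C * 0 ^ 2) := by simpa using h2
  have h4 := (h2'.comp (0 : ℝ) (hp 0)).mul
    (((hasDerivAt_id (0 : ℝ)).const_mul (2 * C)).const_add B)
  have h5 := h4.deriv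
  simp only [Function.comp_def, id] at h5
  refine Eq.trans h5 ?_
  simp; ring

lemma lapl_comp_normSq {G G1 : ℝ → ℝ} {G2 : ℝ} (c x : 𝔼)
    (hG : ContDiffAt ℝ 2 G (‖x - c‖ ^ 2))
    (h1 : ∀ᶠ s in 𝓝 (‖x - c‖ ^ 2), HasDerivAt G (G1 s) s)
    (h2 : HasDerivAt G1 G2 (‖x - c‖ ^ 2)) :
    lapl (fun y : 𝔼 => G (‖y - c‖ ^ 2)) x
      = 4 * ‖x - c‖ ^ 2 * G2 + 2 * N * G1 (‖x - c‖ ^ 2) := by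
  have hC : ContDiffAt ℝ 2 (fun y : 𝔼 => G (‖y - c‖ ^ 2)) x :=
    hG.comp x ((contDiff_id.sub contDiff_const).norm_sq ℝ).contDiffAt
  have key : ∀ i : Fin N, iteratedFDeriv ℝ 2 (fun y : 𝔼 => G (‖y - c‖ ^ 2)) x
      ![EuclideanSpace.single i 1, EuclideanSpace.single i 1]
      = 4 * (x - c) i ^ 2 * G2 + 2 * G1 (‖x - c‖ ^ 2) := by
    intro i
    rw [← deriv_deriv_line hC]
    have : (fun s : ℝ => G (‖x + s • (EuclideanSpace.single i (1 : ℝ) : 𝔼) - c‖ ^ 2))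
        = fun s : ℝ => G (‖x - c‖ ^ 2 + (2 * (x - c) i) * s + 1 * s ^ 2) := by
      ext s
      congr 1
      rw [add_sub_right_comm, norm_add_sq_real, norm_smul, inner_smul_right,
        EuclideanSpace.inner_single_right]
      simp
      ring
    rw [this, deriv_deriv_comp_poly h1 h2]
    ring
  simp only [lapl, key, Finset.sum_add_distrib, ← Finset.sum_mul, ← Finset.mul_sum]
  rw [← EuclideanSpace.real_norm_sq_eq (x - c), Finset.sum_const, Finset.card_univ, Fintype.card_fin,
    nsmul_eq_mul]
  ring

lemma lapl_comp_inner {G G1 : ℝ → ℝ} {G2 : ℝ} (e x : 𝔼) (he : ‖e‖ = 1)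
    (hG : ContDiffAt ℝ 2 G (inner ℝ x e))
    (h1 : ∀ᶠ s in 𝓝 (inner ℝ x e), HasDerivAt G (G1 s) s)
    (h2 : HasDerivAt G1 G2 (inner ℝ x e)) :
    lapl (fun y : 𝔼 => G (inner ℝ y e)) x = G2 := by
  have hC : ContDiffAt ℝ 2 (fun y : 𝔼 => G (inner ℝ y e)) x :=
    hG.comp x (contDiff_id.inner ℝ contDiff_const).contDiffAt
  have key : ∀ i : Fin N, iteratedFDeriv ℝ 2 (fun y : 𝔼 => G (inner ℝ y e)) x
      ![EuclideanSpace.single i 1, EuclideanSpace.single i 1] = e i ^ 2 * G2 := by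
    intro i
    rw [← deriv_deriv_line hC]
    have : (fun s : ℝ => G (inner ℝ (x + s • (EuclideanSpace.single i (1 : ℝ) : 𝔼)) e))
        = fun s : ℝ => G (inner ℝ x e + e i * s + 0 * s ^ 2) := by
      ext s
      congr 1
      rw [inner_add_left, inner_smul_left, EuclideanSpace.inner_single_left]
      simp
      ring
    rw [this, deriv_deriv_comp_poly h1 h2]
    ring
  simp only [lapl, key, ← Finset.sum_mul]
  rw [← EuclideanSpace.real_norm_sq_eq, he]
  simp

lemma lapl_comp_isometry {u : 𝔼 → ℝ} (L : 𝔼 ≃ₗᵢ[ℝ] 𝔼) (p x : 𝔼)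
    (hu : ContDiffAt ℝ 2 u (L x + p)) :
    lapl (fun y => u (L y + p)) x = lapl u (L x + p) := by
  have hC : ContDiffAt ℝ 2 (fun y => u (L y + p)) x :=
    ContDiffAt.comp x (f := fun y => L y + p) hu
      ((L.contDiff.add contDiff_const).contDiffAt)
  rw [lapl_eq_laplacian u, InnerProductSpace.laplacian_eq_iteratedFDeriv_orthonormalBasis u
    ((EuclideanSpace.basisFun (Fin N) ℝ).map L)]
  refine Finset.sum_congr rfl fun i _ => ?_
  rw [← deriv_deriv_line hC, ← deriv_deriv_line hu]
  simp only [map_add, map_smul, OrthonormalBasis.map_apply, EuclideanSpace.basisFun_apply]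
  congr 3
  ext s
  congr 1
  abel

end LaplacianCalculus

section MaximumPrinciple

variable {N : ℕ}

local notation "𝔼" => EuclideanSpace ℝ (Fin N)

/-- A minimum principle on a bounded open set, in the presence of a positive function `φ` which is
a strict supersolution wherever `W` is negative. -/
lemma nonneg_of_lapl_mul_lt {Ω : Set 𝔼} (hΩ : IsOpen Ω) (hbdd : Bornology.IsBounded Ω)
    {W φ : 𝔼 → ℝ} (hW : ∀ x ∈ Ω, ContDiffAt ℝ 2 W x) (hφ : ∀ x ∈ Ω, ContDiffAt ℝ 2 φ x)
    (hφ1 : ∀ x ∈ Ω, 1 ≤ φ x)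
    (hb : ∀ x₀ ∈ closure Ω, x₀ ∉ Ω → ∀ ε > 0, ∀ᶠ x in 𝓝[Ω] x₀, -ε < W x)
    (hL : ∀ x ∈ Ω, W x < 0 → lapl W x * φ x < W x * lapl φ x) :
    ∀ x ∈ Ω, 0 ≤ W x := by
  by_contra! hneg
  obtain ⟨x₁, hx₁, hWx₁⟩ := hneg
  have hφpos : ∀ x ∈ Ω, 0 < φ x := fun x hx => zero_lt_one.trans_le (hφ1 x hx)
  set s : 𝔼 → ℝ := fun x => W x / φ x with hs
  have hs₁ : s x₁ < 0 := div_neg_of_neg_of_pos hWx₁ (hφpos x₁ hx₁)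
  set D : Set 𝔼 := {x ∈ Ω | s x ≤ s x₁} with hD
  have hWs : ∀ x ∈ Ω, W x = s x * φ x := fun x hx => by
    simp [hs, (hφpos x hx).ne']
  have hDW : ∀ x ∈ D, W x ≤ s x₁ := by
    rintro x ⟨hx, hsx⟩
    rw [hWs x hx]
    nlinarith [hφ1 x hx]
  have hDΩ : closure D ⊆ Ω := by
    intro x₀ hx₀
    by_contra hx₀Ω
    have hev := hb x₀ (closure_mono (sep_subset _ _) hx₀) hx₀Ω (-s x₁) (by linarith)
    rw [eventually_nhdsWithin_iff] at hev
    obtain ⟨x, hxD, hx⟩ := ((mem_closure_iff_frequently.1 hx₀).and_eventually hev).exists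
    have := hx hxD.1
    have := hDW x hxD
    linarith
  have hcomp : IsCompact (closure D) := (hbdd.subset (sep_subset _ _)).isCompact_closure
  have hscont : ContinuousOn s (closure D) := fun x hx =>
    ((hW x (hDΩ hx)).continuousAt.div (hφ x (hDΩ hx)).continuousAt
      (hφpos x (hDΩ hx)).ne').continuousWithinAt
  have hx₁D : x₁ ∈ closure D := subset_closure ⟨hx₁, le_rfl⟩
  obtain ⟨x₀, hx₀, hmin⟩ := hcomp.exists_isMinOn ⟨x₁, hx₁D⟩ hscont
  have hx₀Ω := hDΩ hx₀
  have hs₀ : s x₀ ≤ s x₁ := hmin hx₁D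
  have hglob : ∀ x ∈ Ω, s x₀ ≤ s x := by
    intro x hx
    by_cases h : s x ≤ s x₁
    · exact hmin (subset_closure ⟨hx, h⟩)
    · linarith
  have hloc : IsLocalMin (fun x => W x + (-s x₀) * φ x) x₀ := by
    filter_upwards [hΩ.mem_nhds hx₀Ω] with x hx
    rw [hWs x hx, hWs x₀ hx₀Ω]
    nlinarith [hφpos x hx, hglob x hx]
  have hmφ : ContDiffAt ℝ 2 (fun x => (-s x₀) * φ x) x₀ := contDiffAt_const.mul (hφ x₀ hx₀Ω)
  have hnn := lapl_nonneg_of_isLocalMin ((hW x₀ hx₀Ω).add hmφ) hloc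
  rw [lapl_add (hW x₀ hx₀Ω) hmφ, lapl_const_mul _ (hφ x₀ hx₀Ω)] at hnn
  have hW₀ : W x₀ = s x₀ * φ x₀ := hWs x₀ hx₀Ω
  have hlt := hL x₀ hx₀Ω (by rw [hW₀]; nlinarith [hφpos x₀ hx₀Ω])
  rw [hW₀] at hlt
  nlinarith [hφpos x₀ hx₀Ω]

/-- The exponential barrier in a ball: a nonnegative supersolution which is positive
on a smaller concentric ball stays above a positive multiple of the distance to the boundary. -/
lemma exists_lower_bound_of_supersolution {c : 𝔼} {r R : ℝ} (hr : 0 < r) (hR : r < R) {w : 𝔼 → ℝ}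
    (hw : ∀ x ∈ ball c R, ContDiffAt ℝ 2 w x) (hw0 : ∀ x ∈ ball c R, 0 ≤ w x)
    {C : ℝ} (hC : 0 ≤ C) (hL : ∀ x ∈ ball c R, lapl w x ≤ C * w x)
    (hpos : ∀ x ∈ closedBall c r, 0 < w x) :
    ∃ ε > 0, ∀ x ∈ ball c R, ε * (R ^ 2 - ‖x - c‖ ^ 2) ≤ w x := by
  have hsub : closedBall c r ⊆ ball c R := closedBall_subset_ball hR
  obtain ⟨m, hm, hmw⟩ : ∃ m > 0, ∀ x ∈ closedBall c r, m ≤ w x := by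
    obtain ⟨x₀, hx₀, hmin⟩ := (isCompact_closedBall c r).exists_isMinOn
      ⟨c, mem_closedBall_self hr.le⟩
      (fun x hx => (hw x (hsub hx)).continuousAt.continuousWithinAt)
    exact ⟨w x₀, hpos x₀ hx₀, fun x hx => hmin hx⟩
  obtain ⟨α, hα0, hα1⟩ : ∃ α : ℝ, 1 ≤ α ∧ C + 2 * N * α < α ^ 2 * (4 * r ^ 2) := by
    refine ⟨(C + 2 * N + 1) / (4 * r ^ 2) + 1, ?_, ?_⟩
    · have : 0 ≤ (C + 2 * N + 1) / (4 * r ^ 2) := by positivity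
      linarith
    · set A := (C + 2 * N + 1) / (4 * r ^ 2) with hA
      have hA' : A * (4 * r ^ 2) = C + 2 * N + 1 := by rw [hA]; field_simp
      have hA0 : 0 ≤ A := by positivity
      have : (A + 1) ^ 2 * (4 * r ^ 2) = (A + 1) * (C + 2 * N + 1 + 4 * r ^ 2) := by rw [← hA']; ring
      rw [this]
      have hR2 : 0 < 4 * r ^ 2 := by positivity
      nlinarith [mul_nonneg hA0 hC, mul_nonneg hA0 hR2.le]
  set g : ℝ → ℝ := fun s => m * (Real.exp (-α * s) - Real.exp (-α * R ^ 2)) with hg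
  have hexp : ∀ s : ℝ, HasDerivAt (fun s : ℝ => Real.exp (-α * s)) (-α * Real.exp (-α * s)) s :=
    fun s => by
      have := ((hasDerivAt_id s).const_mul (-α)).exp
      simpa [mul_comm] using this
  have hg1 : ∀ s, HasDerivAt g (m * (-α * Real.exp (-α * s))) s := fun s =>
    ((hexp s).sub_const _).const_mul m
  have hg2 : ∀ s, HasDerivAt (fun s => m * (-α * Real.exp (-α * s)))
      (m * (-α * (-α * Real.exp (-α * s)))) s := fun s => ((hexp s).const_mul _).const_mul m
  have hgc : ContDiff ℝ 2 g := by rw [hg]; fun_prop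
  have hsmooth : ∀ x, ContDiffAt ℝ 2 (fun x : 𝔼 => g (‖x - c‖ ^ 2)) x := fun x =>
    (hgc.comp ((contDiff_id.sub contDiff_const).norm_sq ℝ)).contDiffAt
  have hmain : ∀ x ∈ ball c R, 0 ≤ w x - g (‖x - c‖ ^ 2) := by
    refine nonneg_of_lapl_mul_lt (φ := fun _ => 1) isOpen_ball isBounded_ball
      (fun x hx => (hw x hx).sub (hsmooth x)) (fun x _ => contDiffAt_const)
      (fun _ _ => le_rfl) ?_ ?_
    · intro x₀ hx₀ hx₀' ε hε
      have hx₀R : ‖x₀ - c‖ = R := by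
        refine le_antisymm ?_ ?_
        · simpa [dist_eq_norm] using closure_ball_subset_closedBall hx₀
        · simpa [dist_eq_norm] using hx₀'
      have h1 : g (‖x₀ - c‖ ^ 2) < ε := by simp [hg, hx₀R, hε]
      have h2 : ∀ᶠ x in 𝓝[ball c R] x₀, g (‖x - c‖ ^ 2) < ε :=
        (((hsmooth x₀).continuousAt.tendsto).eventually (gt_mem_nhds h1)).filter_mono
          nhdsWithin_le_nhds
      filter_upwards [h2, self_mem_nhdsWithin] with x hx hxR
      have := hw0 x hxR
      linarith
    · intro x hx hneg
      have hlap1 : lapl (fun _ : 𝔼 => (1 : ℝ)) x = 0 := by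
        simp [lapl_eq_laplacian]
      rw [hlap1, mul_zero, mul_one, lapl_sub (hw x hx) (hsmooth x),
        lapl_comp_normSq c x hgc.contDiffAt (Eventually.of_forall hg1) (hg2 _)]
      set q := ‖x - c‖ ^ 2 with hq
      have hq4 : r ^ 2 ≤ q := by
        by_contra! hlt
        have hxm : x ∈ closedBall c r := by
          rw [mem_closedBall, dist_eq_norm]
          exact abs_le_of_sq_le_sq' (by rw [← hq]; nlinarith) (by linarith) |>.2
        have h1 := hmw x hxm
        have h2 : g q ≤ m := by
          have e1 : Real.exp (-α * q) ≤ 1 := Real.exp_le_one_iff.2 (by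
            have : 0 ≤ q := by positivity
            nlinarith)
          have e2 := Real.exp_pos (-α * R ^ 2)
          simp only [hg]
          nlinarith
        linarith
      have hE := Real.exp_pos (-α * q)
      have hgle : g q ≤ m * Real.exp (-α * q) := by
        simp only [hg]
        have e2 := Real.exp_pos (-α * R ^ 2)
        nlinarith
      have hwle := hL x hx
      have key : C * (m * Real.exp (-α * q))
          < 4 * q * (m * (-α * (-α * Real.exp (-α * q))))
            + 2 * N * (m * (-α * Real.exp (-α * q))) := by
        have hmE : 0 < m * Real.exp (-α * q) := by positivity
        have : C < 4 * q * α ^ 2 - 2 * N * α := by nlinarith [sq_nonneg α]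
        nlinarith
      have h3 : C * w x ≤ C * g q := mul_le_mul_of_nonneg_left (by linarith) hC
      have h4 : C * g q ≤ C * (m * Real.exp (-α * q)) := mul_le_mul_of_nonneg_left hgle hC
      linarith
  refine ⟨m * Real.exp (-α * R ^ 2), by positivity, fun x hx => ?_⟩
  have h1 := hmain x hx
  set q := ‖x - c‖ ^ 2 with hq
  have hqR : 0 ≤ R ^ 2 - q := by
    have : ‖x - c‖ < R := by simpa [dist_eq_norm] using hx
    have := pow_le_pow_left₀ (norm_nonneg _) this.le 2
    linarith
  have h2 : Real.exp (-α * R ^ 2) * (1 + α * (R ^ 2 - q)) ≤ Real.exp (-α * q) := by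
    have e : Real.exp (-α * q) = Real.exp (-α * R ^ 2) * Real.exp (α * (R ^ 2 - q)) := by
      rw [← Real.exp_add]; ring_nf
    rw [e]
    refine mul_le_mul_of_nonneg_left ?_ (Real.exp_pos _).le
    linarith [Real.add_one_le_exp (α * (R ^ 2 - q))]
  have h3 : m * Real.exp (-α * R ^ 2) * (R ^ 2 - q) ≤ g q := by
    simp only [hg]
    have hE := Real.exp_pos (-α * R ^ 2)
    have h5 : Real.exp (-α * R ^ 2) * (R ^ 2 - q) ≤ Real.exp (-α * R ^ 2) * (α * (R ^ 2 - q)) :=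
      mul_le_mul_of_nonneg_left (by nlinarith) hE.le
    rw [mul_assoc]
    exact mul_le_mul_of_nonneg_left (by linarith) hm.le
  linarith

end MaximumPrinciple

section MovingPlanes

variable {N : ℕ}

local notation "𝔼" => EuclideanSpace ℝ (Fin N)

/-- Reflection across the hyperplane `{x | ⟪x, e⟫ = l}`, for a unit vector `e`. -/
noncomputable def planeReflection (e : 𝔼) (l : ℝ) (x : 𝔼) : 𝔼 :=
  (ℝ ∙ e)ᗮ.reflection x + (2 * l) • e

lemma planeReflection_eq {e : 𝔼} (he : ‖e‖ = 1) (l : ℝ) (x : 𝔼) :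
    planeReflection e l x = x - (2 * (inner ℝ x e - l)) • e := by
  rw [planeReflection, Submodule.reflection_orthogonal_apply, Submodule.reflection_singleton_apply,
    he, real_inner_comm]
  simp only [RCLike.ofReal_real_eq_id, id, one_pow, div_one]
  module

lemma continuous_planeReflection {e : 𝔼} (he : ‖e‖ = 1) :
    Continuous fun z : ℝ × 𝔼 => planeReflection e z.1 z.2 := by
  simp only [planeReflection_eq he]
  fun_prop

lemma continuous_planeReflection_right {e : 𝔼} (l : ℝ) : Continuous (planeReflection e l) := by
  unfold planeReflection
  fun_prop

lemma norm_planeReflection_sq {e : 𝔼} (he : ‖e‖ = 1) (l : ℝ) (x : 𝔼) :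
    ‖planeReflection e l x‖ ^ 2 = ‖x‖ ^ 2 - 4 * l * (inner ℝ x e - l) := by
  rw [planeReflection_eq he, norm_sub_sq_real, inner_smul_right, norm_smul, he, mul_one,
    Real.norm_eq_abs, sq_abs]
  ring

lemma planeReflection_of_inner_eq {e : 𝔼} (he : ‖e‖ = 1) {l : ℝ} {x : 𝔼} (h : inner ℝ x e = l) :
    planeReflection e l x = x := by
  rw [planeReflection_eq he, h]; simp

lemma norm_planeReflection_le {e : 𝔼} (he : ‖e‖ = 1) {l : ℝ} (hl : 0 ≤ l) {x : 𝔼}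
    (h : l ≤ inner ℝ x e) : ‖planeReflection e l x‖ ≤ ‖x‖ := by
  refine abs_le_of_sq_le_sq' ?_ (norm_nonneg _) |>.2
  rw [norm_planeReflection_sq he]
  nlinarith

lemma norm_planeReflection_lt {e : 𝔼} (he : ‖e‖ = 1) {l : ℝ} (hl : 0 < l) {x : 𝔼}
    (h : l < inner ℝ x e) : ‖planeReflection e l x‖ < ‖x‖ := by
  refine abs_lt_of_sq_lt_sq ?_ (norm_nonneg _) |> lt_of_abs_lt
  rw [norm_planeReflection_sq he]
  nlinarith

/-- Near the unit sphere `u` is, up to an arbitrarily small error,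
nondecreasing in the norm. -/
def AlmostRadiallyMonotone (u : 𝔼 → ℝ) : Prop :=
  ∀ ε > 0, ∃ ρ < 1, ∀ x ∈ ball (0 : 𝔼) 1, ∀ y ∈ ball (0 : 𝔼) 1,
    ρ < ‖y‖ → ‖y‖ ≤ ‖x‖ → u y - ε < u x

lemma IsLargeSolution.contDiffAt {f : ℝ → ℝ} {u : 𝔼 → ℝ} (hu : IsLargeSolution f u) {x : 𝔼}
    (hx : ‖x‖ < 1) : ContDiffAt ℝ 2 u x :=
  hu.1.contDiffAt (isOpen_ball.mem_nhds (by simpa using hx))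

lemma IsLargeSolution.contDiffAt_planeReflection {f : ℝ → ℝ} {u : 𝔼 → ℝ}
    (hu : IsLargeSolution f u) {e x : 𝔼} {l : ℝ} (hx : ‖planeReflection e l x‖ < 1) :
    ContDiffAt ℝ 2 (fun y => u (planeReflection e l y)) x := by
  refine ContDiffAt.comp (f := planeReflection e l) x (hu.contDiffAt hx) ?_
  unfold planeReflection
  exact ((ℝ ∙ e)ᗮ.reflection.contDiff.add contDiff_const).contDiffAt

lemma IsLargeSolution.lapl_sub_planeReflection {f : ℝ → ℝ} {u : 𝔼 → ℝ}
    (hu : IsLargeSolution f u) {e x : 𝔼} {l : ℝ} (hx : ‖x‖ < 1)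
    (hx' : ‖planeReflection e l x‖ < 1) :
    lapl (fun y => u y - u (planeReflection e l y)) x
      = f (u x) - f (u (planeReflection e l x)) := by
  rw [lapl_sub (hu.contDiffAt hx) (hu.contDiffAt_planeReflection hx'), hu.2.1 x (by simpa using hx),
    ← hu.2.1 (planeReflection e l x) (by simpa using hx')]
  congr 1
  exact lapl_comp_isometry (ℝ ∙ e)ᗮ.reflection ((2 * l) • e) x (hu.contDiffAt hx')

lemma IsLargeSolution.eventually_gt {f : ℝ → ℝ} {u : 𝔼 → ℝ} (hu : IsLargeSolution f u) {x₀ : 𝔼}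
    (hx₀ : ‖x₀‖ = 1) (M : ℝ) : ∀ᶠ x in 𝓝 x₀, x ∈ ball (0 : 𝔼) 1 → M < u x :=
  eventually_nhdsWithin_iff.1 ((hu.2.2 x₀ (by simpa using hx₀)).eventually_gt_atTop M)

lemma exp_barrier_inequality {k b t : ℝ} (hk : 0 ≤ k) (hb : b = 3 * (k + 1)) (ht : b * t ≤ 1) :
    2 * k < b ^ 2 * Real.exp (-b * t) := by
  have h1 : Real.exp (-1) ≤ Real.exp (-b * t) := Real.exp_le_exp.2 (by linarith)
  have h2 : 1 / 3 < Real.exp (-1) := by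
    rw [Real.exp_neg, ← one_div]
    exact one_div_lt_one_div_of_lt (Real.exp_pos 1) Real.exp_one_lt_three
  have h3 : b ^ 2 * (1 / 3) ≤ b ^ 2 * Real.exp (-b * t) :=
    mul_le_mul_of_nonneg_left (by linarith) (sq_nonneg b)
  rw [hb] at h3 ⊢
  nlinarith

/-- If the reflected solution lies below `u` on the part of the cap at distance at least
`(3 * (k + 1))⁻¹` from the hyperplane, then it does so on the whole cap. -/
lemma IsLargeSolution.planeReflection_le_of_far {f : ℝ → ℝ} {u : 𝔼 → ℝ}
    (hu : IsLargeSolution f u) (hord : AlmostRadiallyMonotone u)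
    {k : ℝ} (hk : 0 ≤ k) (hfk : ∀ s t, s ≤ t → f s - f t ≤ k * (t - s))
    {e : 𝔼} (he : ‖e‖ = 1) {l : ℝ} (hl : 0 < l)
    (hfar : ∀ x ∈ ball (0 : 𝔼) 1, l + 1 / (3 * (k + 1)) ≤ inner ℝ x e →
      u (planeReflection e l x) ≤ u x) :
    ∀ x ∈ ball (0 : 𝔼) 1, l < inner ℝ x e → u (planeReflection e l x) ≤ u x := by
  set b : ℝ := 3 * (k + 1) with hb
  have hb0 : 0 < b := by positivity
  set Ω : Set 𝔼 := ball 0 1 ∩ {x | l < inner ℝ x e} with hΩ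
  have hΩo : IsOpen Ω := isOpen_ball.inter (isOpen_lt continuous_const (by fun_prop))
  have hin : ∀ x ∈ Ω, ‖x‖ < 1 ∧ ‖planeReflection e l x‖ < 1 := fun x hx => by
    have h1 : ‖x‖ < 1 := by simpa using hx.1
    exact ⟨h1, (norm_planeReflection_le he hl.le hx.2.le).trans_lt h1⟩
  set g : ℝ → ℝ := fun s => 2 - Real.exp (-b * (s - l)) with hg
  have hexp : ∀ s : ℝ, HasDerivAt (fun s : ℝ => Real.exp (-b * (s - l)))
      (-b * Real.exp (-b * (s - l))) s := fun s => by
    have := (((hasDerivAt_id s).sub_const l).const_mul (-b)).exp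
    simpa [mul_comm] using this
  have hg1 : ∀ s, HasDerivAt g (-(-b * Real.exp (-b * (s - l)))) s := fun s =>
    (hexp s).const_sub 2
  have hg2 : ∀ s, HasDerivAt (fun s => -(-b * Real.exp (-b * (s - l))))
      (-(-b * (-b * Real.exp (-b * (s - l))))) s := fun s => ((hexp s).const_mul _).neg
  have hgc : ContDiff ℝ 2 g := by rw [hg]; fun_prop
  have hmain : ∀ x ∈ Ω, 0 ≤ u x - u (planeReflection e l x) := by
    refine nonneg_of_lapl_mul_lt (φ := fun x => g (inner ℝ x e)) hΩo
      (isBounded_ball.subset inter_subset_left)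
      (fun x hx => (hu.contDiffAt (hin x hx).1).sub (hu.contDiffAt_planeReflection (hin x hx).2))
      (fun x _ => (hgc.comp (contDiff_id.inner ℝ contDiff_const)).contDiffAt) ?_ ?_ ?_
    · rintro x ⟨-, hx⟩
      have : Real.exp (-b * (inner ℝ x e - l)) ≤ 1 := Real.exp_le_one_iff.2 (by
        have : 0 < inner ℝ x e - l := sub_pos.2 hx
        nlinarith)
      simp only [hg]
      linarith
    · intro x₀ hx₀ hx₀Ω ε hε
      have hx₀1 : ‖x₀‖ ≤ 1 := by
        simpa using closure_ball_subset_closedBall (closure_mono inter_subset_left hx₀)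
      have hx₀l : l ≤ inner ℝ x₀ e :=
        closure_lt_subset_le continuous_const (by fun_prop) (closure_mono inter_subset_right hx₀)
      have hRc : Tendsto (planeReflection e l) (𝓝 x₀) (𝓝 (planeReflection e l x₀)) :=
        (continuous_planeReflection_right l).tendsto x₀
      rcases hx₀1.lt_or_eq with hlt | heq
      · have hxe : inner ℝ x₀ e = l := by
          refine le_antisymm ?_ hx₀l
          by_contra! h
          exact hx₀Ω ⟨by simpa using hlt, h⟩
        have hRx := planeReflection_of_inner_eq he hxe
        have hc : ContinuousAt (fun x => u x - u (planeReflection e l x)) x₀ :=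
          (hu.contDiffAt hlt).continuousAt.sub
            (hu.contDiffAt_planeReflection (by rwa [hRx])).continuousAt
        refine (hc.tendsto.eventually (lt_mem_nhds ?_)).filter_mono nhdsWithin_le_nhds
        rw [hRx]
        linarith
      · rcases hx₀l.lt_or_eq with hlt | hle
        · have hR1 : ‖planeReflection e l x₀‖ < 1 := heq ▸ norm_planeReflection_lt he hl hlt
          have h1 : ∀ᶠ x in 𝓝 x₀, u (planeReflection e l x) < u (planeReflection e l x₀) + 1 :=
            (hu.contDiffAt_planeReflection hR1).continuousAt.tendsto.eventually
              (gt_mem_nhds (by linarith))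
          filter_upwards [h1.filter_mono nhdsWithin_le_nhds, self_mem_nhdsWithin,
            (hu.eventually_gt heq (u (planeReflection e l x₀) + 1)).filter_mono
              nhdsWithin_le_nhds] with x h1 h2 h3
          have := h3 h2.1
          linarith
        · obtain ⟨ρ, hρ, h⟩ := hord ε hε
          have hRx := planeReflection_of_inner_eq he hle.symm
          have h1 : ∀ᶠ x in 𝓝 x₀, ρ < ‖planeReflection e l x‖ := by
            refine hRc.norm.eventually (lt_mem_nhds ?_)
            rwa [hRx, heq]
          filter_upwards [h1.filter_mono nhdsWithin_le_nhds, self_mem_nhdsWithin] with x h1 h2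
          have := h x h2.1 _ (by simpa using (hin x h2).2) h1
            (norm_planeReflection_le he hl.le h2.2.le)
          linarith
    · intro x hx hneg
      have hstrip : inner ℝ x e - l < 1 / b := by
        by_contra! h
        have := hfar x hx.1 (by linarith)
        linarith
      have hbt : b * (inner ℝ x e - l) ≤ 1 := by
        rw [lt_div_iff₀ hb0] at hstrip
        linarith
      rw [hu.lapl_sub_planeReflection (hin x hx).1 (hin x hx).2,
        lapl_comp_inner e x he hgc.contDiffAt (Eventually.of_forall hg1) (hg2 _)]
      have h1 := hfk (u x) (u (planeReflection e l x)) (by linarith)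
      have h2 := exp_barrier_inequality hk hb hbt
      have hE := Real.exp_pos (-b * (inner ℝ x e - l))
      have hx0 : 0 < inner ℝ x e - l := sub_pos.2 hx.2
      have h3 : Real.exp (-b * (inner ℝ x e - l)) < 1 := by
        rw [← Real.exp_zero]
        exact Real.exp_lt_exp.2 (by nlinarith)
      have hg0 : 1 < g (inner ℝ x e) := by simp only [hg]; linarith
      have hg2' : g (inner ℝ x e) < 2 := by simp only [hg]; linarith
      set W := u x - u (planeReflection e l x) with hW
      have h4 : (f (u x) - f (u (planeReflection e l x))) * g (inner ℝ x e)
          ≤ -(k * W) * g (inner ℝ x e) := mul_le_mul_of_nonneg_right (by linarith) (by linarith)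
      have h5 : k * g (inner ℝ x e) < b ^ 2 * Real.exp (-b * (inner ℝ x e - l)) := by nlinarith
      nlinarith
  intro x hx hxl
  linarith [hmain x ⟨hx, hxl⟩]

lemma exists_one_sided_lipschitz {f : ℝ → ℝ} (hf : ContDiff ℝ 1 f) {K : Set ℝ}
    (hK : IsCompact K) : ∃ C ≥ 0, ∀ s ∈ K, ∀ t ∈ K, s ≤ t → f t - f s ≤ C * (t - s) := by
  obtain ⟨C, hC⟩ :=
    (hf.locallyLipschitz.locallyLipschitzOn (s := K)).exists_lipschitzOnWith_of_compact hK
  refine ⟨C, C.2, fun s hs t ht hst => ?_⟩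
  have := hC.dist_le_mul t ht s hs
  rw [Real.dist_eq, Real.dist_eq, abs_of_nonneg (sub_nonneg.2 hst)] at this
  exact (le_abs_self _).trans this

lemma IsLargeSolution.exists_lapl_sub_le {f : ℝ → ℝ} (hf : ContDiff ℝ 1 f) {u : 𝔼 → ℝ}
    (hu : IsLargeSolution f u) {e : 𝔼} {l : ℝ} {K : Set 𝔼} (hK : IsCompact K)
    (hK1 : ∀ x ∈ K, ‖x‖ < 1) (hK2 : ∀ x ∈ K, ‖planeReflection e l x‖ < 1)
    (hle : ∀ x ∈ K, u (planeReflection e l x) ≤ u x) :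
    ∃ C ≥ 0, ∀ x ∈ K, lapl (fun y => u y - u (planeReflection e l y)) x
      ≤ C * (u x - u (planeReflection e l x)) := by
  have h1 : IsCompact (u '' K) :=
    hK.image_of_continuousOn fun x hx => (hu.contDiffAt (hK1 x hx)).continuousAt.continuousWithinAt
  have h2 : IsCompact ((fun y => u (planeReflection e l y)) '' K) :=
    hK.image_of_continuousOn fun x hx =>
      (hu.contDiffAt_planeReflection (hK2 x hx)).continuousAt.continuousWithinAt
  obtain ⟨C, hC0, hC⟩ := exists_one_sided_lipschitz hf (h1.union h2)
  refine ⟨C, hC0, fun x hx => ?_⟩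
  rw [hu.lapl_sub_planeReflection (hK1 x hx) (hK2 x hx)]
  exact hC _ (Or.inr ⟨x, hx, rfl⟩) _ (Or.inl ⟨x, hx, rfl⟩) (hle x hx)

/-- Strong maximum principle for the difference of `u` and its reflection in a cap. -/
lemma IsLargeSolution.planeReflection_lt {f : ℝ → ℝ} (hf : ContDiff ℝ 1 f) {u : 𝔼 → ℝ}
    (hu : IsLargeSolution f u) {e : 𝔼} (he : ‖e‖ = 1) {l : ℝ} (hl : 0 < l)
    (hle : ∀ x ∈ ball (0 : 𝔼) 1, l < inner ℝ x e → u (planeReflection e l x) ≤ u x) :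
    ∀ x ∈ ball (0 : 𝔼) 1, l < inner ℝ x e → u (planeReflection e l x) < u x := by
  intro x hx hxl
  set Ω : Set 𝔼 := ball 0 1 ∩ {x | l < inner ℝ x e} with hΩ
  have hΩo : IsOpen Ω := isOpen_ball.inter (isOpen_lt continuous_const (by fun_prop))
  have hΩc : Convex ℝ Ω := by
    refine (convex_ball 0 1).inter ?_
    have : {x : 𝔼 | l < inner ℝ x e} = {x : 𝔼 | l < innerSL ℝ e x} := by
      ext x; simp [real_inner_comm]
    rw [this]
    exact convex_halfSpace_gt (innerSL ℝ e).isLinear l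
  have hin : ∀ x ∈ Ω, ‖x‖ < 1 ∧ ‖planeReflection e l x‖ < 1 := fun x hx => by
    have h1 : ‖x‖ < 1 := by simpa using hx.1
    exact ⟨h1, (norm_planeReflection_le he hl.le hx.2.le).trans_lt h1⟩
  set W : 𝔼 → ℝ := fun x => u x - u (planeReflection e l x) with hW
  have hWc : ∀ x ∈ Ω, ContDiffAt ℝ 2 W x := fun x hx =>
    (hu.contDiffAt (hin x hx).1).sub (hu.contDiffAt_planeReflection (hin x hx).2)
  have hl1 : l < 1 := by
    have h1 : ‖x‖ < 1 := by simpa using hx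
    have := real_inner_le_norm x e
    rw [he] at this
    linarith
  set A : Set 𝔼 := {x ∈ Ω | 0 < W x} with hA
  have hAo : IsOpen A := by
    rw [isOpen_iff_mem_nhds]
    rintro x ⟨hx, hWx⟩
    filter_upwards [hΩo.mem_nhds hx,
      (hWc x hx).continuousAt.tendsto.eventually (lt_mem_nhds hWx)] with y h1 h2 using ⟨h1, h2⟩
  have hne : (Ω ∩ A).Nonempty := by
    have hee : inner ℝ e e = (1 : ℝ) := by rw [real_inner_self_eq_norm_sq, he]; norm_num
    have hR1 : ‖planeReflection e l e‖ < 1 :=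
      he ▸ norm_planeReflection_lt he hl (by rwa [hee])
    have h1 : ∀ᶠ x in 𝓝 e, u (planeReflection e l x) < u (planeReflection e l e) + 1 :=
      (hu.contDiffAt_planeReflection hR1).continuousAt.tendsto.eventually
        (gt_mem_nhds (by linarith))
    have h2 := hu.eventually_gt he (u (planeReflection e l e) + 1)
    have h3 : ∀ᶠ x in 𝓝 e, l < inner ℝ x e :=
      (isOpen_lt continuous_const (by fun_prop)).mem_nhds (by show l < inner ℝ e e; rw [hee]; exact hl1)
    have h4 : e ∈ closure (ball (0 : 𝔼) 1) := by
      rw [closure_ball _ one_ne_zero]; simp [he]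
    obtain ⟨y, hy, ⟨h1, h2⟩, h3⟩ :=
      ((mem_closure_iff_frequently.1 h4).and_eventually ((h1.and h2).and h3)).exists
    have := h2 hy
    exact ⟨y, ⟨hy, h3⟩, ⟨hy, h3⟩, by simp only [hW]; linarith⟩
  have hcl : closure A ∩ Ω ⊆ A := by
    rintro x₀ ⟨hx₀, hx₀Ω⟩
    refine ⟨hx₀Ω, ?_⟩
    obtain ⟨d, hd, hdΩ⟩ := Metric.isOpen_iff.1 hΩo x₀ hx₀Ω
    obtain ⟨y, hyA, hy⟩ := Metric.mem_closure_iff.1 hx₀ (d / 4) (by positivity)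
    obtain ⟨r, hr, hrA⟩ := Metric.isOpen_iff.1 hAo y hyA
    have hyΩ : closedBall y (d / 2) ⊆ Ω := (closedBall_subset_ball' (by
      rw [dist_comm] at hy; linarith)).trans hdΩ
    obtain ⟨C, hC0, hC⟩ := hu.exists_lapl_sub_le hf (e := e) (l := l)
      (isCompact_closedBall y (d / 2)) (fun x hx => (hin x (hyΩ hx)).1)
      (fun x hx => (hin x (hyΩ hx)).2) (fun x hx => hle x (hyΩ hx).1 (hyΩ hx).2)
    obtain ⟨ε, hε, h⟩ := exists_lower_bound_of_supersolution (c := y) (r := min (r / 2) (d / 4))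
      (R := d / 2) (w := W) (by positivity) ((min_le_right _ _).trans_lt (by linarith))
      (fun x hx => hWc x (hyΩ (ball_subset_closedBall hx)))
      (fun x hx => sub_nonneg.2
        (hle x (hyΩ (ball_subset_closedBall hx)).1 (hyΩ (ball_subset_closedBall hx)).2))
      hC0 (fun x hx => hC x (ball_subset_closedBall hx))
      (fun x hx => (hrA (closedBall_subset_ball ((min_le_left _ _).trans_lt (by linarith)) hx)).2)
    have hxy : ‖x₀ - y‖ < d / 4 := by rwa [← dist_eq_norm]
    have h1 := h x₀ (by rw [mem_ball]; linarith)
    have h2 : 0 < (d / 2) ^ 2 - ‖x₀ - y‖ ^ 2 := by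
      have := norm_nonneg (x₀ - y)
      nlinarith
    have : 0 < ε * ((d / 2) ^ 2 - ‖x₀ - y‖ ^ 2) := by positivity
    linarith
  have := hΩc.isPreconnected.subset_of_closure_inter_subset hAo hne hcl ⟨hx, hxl⟩
  have := this.2
  simp only [hW] at this
  linarith

end MovingPlanes

section Symmetry

variable {N : ℕ}

local notation "𝔼" => EuclideanSpace ℝ (Fin N)

/-- On the cap `{x | l < ⟪x, e⟫}` the reflected function lies below `u`. -/
def ReflectionLE (u : 𝔼 → ℝ) (e : 𝔼) (l : ℝ) : Prop :=
  ∀ x ∈ ball (0 : 𝔼) 1, l < inner ℝ x e → u (planeReflection e l x) ≤ u x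

lemma IsLargeSolution.eventually_reflectionLE {f : ℝ → ℝ} (hf : ContDiff ℝ 1 f) {u : 𝔼 → ℝ}
    (hu : IsLargeSolution f u) (hord : AlmostRadiallyMonotone u)
    {k : ℝ} (hk : 0 ≤ k) (hfk : ∀ s t, s ≤ t → f s - f t ≤ k * (t - s))
    {e : 𝔼} (he : ‖e‖ = 1) {l : ℝ} (hl : 0 < l) (hle : ReflectionLE u e l) :
    ∀ᶠ l' in 𝓝 l, ReflectionLE u e l' := by
  have hstrict := hu.planeReflection_lt hf he hl hle
  set δ : ℝ := 1 / (3 * (k + 1)) with hδ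
  have hδ0 : 0 < δ := by positivity
  set D : Set 𝔼 := closedBall 0 1 ∩ {x | l + δ / 2 ≤ inner ℝ x e} with hD
  have hDc : IsCompact D :=
    (isCompact_closedBall 0 1).inter_right (isClosed_le continuous_const (by fun_prop))
  have hev : ∀ᶠ l' in 𝓝 l, ∀ x ∈ D, x ∈ ball (0 : 𝔼) 1 → u (planeReflection e l' x) ≤ u x := by
    refine hDc.eventually_forall_of_forall_eventually fun x₀ hx₀ => ?_
    have hx₀1 : ‖x₀‖ ≤ 1 := by simpa using hx₀.1
    have hx₀l : l < inner ℝ x₀ e := by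
      have : l + δ / 2 ≤ inner ℝ x₀ e := hx₀.2
      linarith
    have hR1 := (norm_planeReflection_lt he hl hx₀l).trans_le hx₀1
    have hRt : Tendsto (fun z : ℝ × 𝔼 => u (planeReflection e z.1 z.2)) (𝓝 (l, x₀))
        (𝓝 (u (planeReflection e l x₀))) :=
      (hu.contDiffAt hR1).continuousAt.tendsto.comp
        ((continuous_planeReflection he).tendsto (l, x₀))
    have hsnd : Tendsto (fun z : ℝ × 𝔼 => z.2) (𝓝 (l, x₀)) (𝓝 x₀) := continuous_snd.tendsto _
    rcases hx₀1.lt_or_eq with hlt | heq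
    · have h1 := hRt.eventually_lt ((hu.contDiffAt hlt).continuousAt.tendsto.comp hsnd)
        (hstrict x₀ (by simpa using hlt) hx₀l)
      filter_upwards [h1] with z hz _ using hz.le
    · have h1 := hRt.eventually (gt_mem_nhds (lt_add_one _))
      have h2 := hsnd.eventually (hu.eventually_gt heq (u (planeReflection e l x₀) + 1))
      filter_upwards [h1, h2] with z h1 h2 hz using (h1.trans (h2 hz)).le
  filter_upwards [hev, lt_mem_nhds hl, lt_mem_nhds (show l - δ / 2 < l by linarith)]
    with l' h1 h2 h3
  refine hu.planeReflection_le_of_far hord hk hfk he h2 fun x hx hxl => h1 x ⟨?_, ?_⟩ hx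
  · exact ball_subset_closedBall hx
  · show l + δ / 2 ≤ inner ℝ x e
    linarith

lemma IsLargeSolution.reflectionLE_of_mem_closure {f : ℝ → ℝ} {u : 𝔼 → ℝ}
    (hu : IsLargeSolution f u) {e : 𝔼} (he : ‖e‖ = 1) {l : ℝ} (hl : 0 ≤ l)
    (hcl : l ∈ closure {l | ReflectionLE u e l}) : ReflectionLE u e l := by
  intro x hx hxl
  by_contra! hlt
  have hR : ‖planeReflection e l x‖ < 1 :=
    (norm_planeReflection_le he hl hxl.le).trans_lt (by simpa using hx)
  have hRt : Tendsto (fun l' => u (planeReflection e l' x)) (𝓝 l)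
      (𝓝 (u (planeReflection e l x))) :=
    (hu.contDiffAt hR).continuousAt.tendsto.comp
      (((continuous_planeReflection he).comp (by fun_prop : Continuous fun l' => (l', x))).tendsto l)
  obtain ⟨l', h1, h2, h3⟩ := ((mem_closure_iff_frequently.1 hcl).and_eventually
    ((hRt.eventually (lt_mem_nhds hlt)).and (gt_mem_nhds hxl))).exists
  exact (h1 x hx h3).not_gt h2

lemma IsLargeSolution.reflectionLE {f : ℝ → ℝ} (hf : ContDiff ℝ 1 f) {u : 𝔼 → ℝ}
    (hu : IsLargeSolution f u) (hord : AlmostRadiallyMonotone u)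
    {k : ℝ} (hk : 0 ≤ k) (hfk : ∀ s t, s ≤ t → f s - f t ≤ k * (t - s))
    {e : 𝔼} (he : ‖e‖ = 1) {l : ℝ} (hl : 0 ≤ l) : ReflectionLE u e l := by
  set S : Set ℝ := {l | 0 < l ∧ ReflectionLE u e l} with hS
  have hSo : IsOpen S := by
    rw [isOpen_iff_mem_nhds]
    rintro l ⟨hl, hle⟩
    exact (lt_mem_nhds hl).and (hu.eventually_reflectionLE hf hord hk hfk he hl hle)
  have hpos : Ioi (0 : ℝ) ⊆ S := by
    refine isPreconnected_Ioi.subset_of_closure_inter_subset hSo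
      ⟨1, mem_Ioi.2 one_pos, one_pos, fun x hx hxl => ?_⟩ ?_
    · have h1 : ‖x‖ < 1 := by simpa using hx
      have := real_inner_le_norm x e
      rw [he] at this
      linarith
    · rintro l ⟨hl, hl0⟩
      exact ⟨hl0, hu.reflectionLE_of_mem_closure he (le_of_lt hl0)
        (closure_mono (fun l h => h.2) hl)⟩
  refine hu.reflectionLE_of_mem_closure he hl (closure_mono (fun l h => (hpos h).2) ?_)
  rw [closure_Ioi]
  exact hl

lemma IsLargeSolution.le_of_norm_eq {f : ℝ → ℝ} (hf : ContDiff ℝ 1 f) {u : 𝔼 → ℝ}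
    (hu : IsLargeSolution f u) (hord : AlmostRadiallyMonotone u)
    {k : ℝ} (hk : 0 ≤ k) (hfk : ∀ s t, s ≤ t → f s - f t ≤ k * (t - s))
    {x y : 𝔼} (hx : x ∈ ball (0 : 𝔼) 1) (hxy : ‖x‖ = ‖y‖) : u y ≤ u x := by
  rcases eq_or_ne x y with rfl | hne
  · rfl
  have hpos : 0 < ‖x - y‖ := norm_pos_iff.2 (sub_ne_zero.2 hne)
  have hin : inner ℝ x (x - y) = ‖x - y‖ ^ 2 / 2 := by
    rw [norm_sub_sq_real, inner_sub_right, real_inner_self_eq_norm_sq, hxy]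
    ring
  have he : ‖‖x - y‖⁻¹ • (x - y)‖ = 1 := norm_smul_inv_norm (sub_ne_zero.2 hne)
  have hinner : inner ℝ x (‖x - y‖⁻¹ • (x - y)) = ‖x - y‖ / 2 := by
    rw [inner_smul_right, hin]; field_simp
  have h := hu.reflectionLE hf hord hk hfk he le_rfl x hx (by rw [hinner]; positivity)
  rwa [planeReflection_eq he, hinner, smul_smul,
    show 2 * (‖x - y‖ / 2 - 0) * ‖x - y‖⁻¹ = 1 by field_simp; ring, one_smul, sub_sub_cancel] at h

/-- Hopf's lemma for `u` minus its reflection. -/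
lemma IsLargeSolution.fderiv_pos {f : ℝ → ℝ} (hf : ContDiff ℝ 1 f) {u : 𝔼 → ℝ}
    (hu : IsLargeSolution f u) (hord : AlmostRadiallyMonotone u)
    {k : ℝ} (hk : 0 ≤ k) (hfk : ∀ s t, s ≤ t → f s - f t ≤ k * (t - s))
    {x : 𝔼} (hx : x ∈ ball (0 : 𝔼) 1) (hx0 : x ≠ 0) : 0 < fderiv ℝ u x (‖x‖⁻¹ • x) := by
  set e : 𝔼 := ‖x‖⁻¹ • x with hee
  set l : ℝ := ‖x‖ with hl
  have hl0 : 0 < l := norm_pos_iff.2 hx0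
  have hl1 : l < 1 := by simpa using hx
  have he : ‖e‖ = 1 := norm_smul_inv_norm hx0
  have hxe : x = l • e := by rw [hee, smul_smul, mul_inv_cancel₀ hl0.ne', one_smul]
  have heI : inner ℝ e e = (1 : ℝ) := by rw [real_inner_self_eq_norm_sq, he]; norm_num
  have hle := hu.reflectionLE hf hord hk hfk he hl0.le
  have hlt := hu.planeReflection_lt hf he hl0 hle
  set R : ℝ := (1 - l) / 4 with hR
  have hR0 : 0 < R := by rw [hR]; linarith
  set c : 𝔼 := (l + R) • e with hc
  set W : 𝔼 → ℝ := fun y => u y - u (planeReflection e l y) with hW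
  have hcap : ∀ y, ‖y - c‖ ≤ R → ‖y‖ < 1 ∧ l ≤ inner ℝ y e := fun y hy => by
    constructor
    · have h1 : ‖c‖ = l + R := by rw [hc, norm_smul, he, Real.norm_of_nonneg (by linarith), mul_one]
      have := norm_le_norm_add_norm_sub' y c
      linarith
    · have h1 := abs_le.1 (abs_real_inner_le_norm (y - c) e)
      rw [inner_sub_left, hc, inner_smul_left, heI, he] at h1
      simp only [conj_trivial] at h1
      rw [hc] at hy
      linarith [h1.1]
  have hcap' : ∀ y, ‖y - c‖ < R → l < inner ℝ y e := fun y hy => by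
    have h1 := abs_le.1 (abs_real_inner_le_norm (y - c) e)
    rw [inner_sub_left, hc, inner_smul_left, heI, he] at h1
    simp only [conj_trivial] at h1
    rw [hc] at hy
    linarith [h1.1]
  have hrefl : ∀ y, ‖y - c‖ ≤ R → ‖planeReflection e l y‖ < 1 := fun y hy =>
    (norm_planeReflection_le he hl0.le (hcap y hy).2).trans_lt (hcap y hy).1
  have hWnn : ∀ y, ‖y - c‖ ≤ R → u (planeReflection e l y) ≤ u y := fun y hy => by
    rcases (hcap y hy).2.lt_or_eq with h | h
    · exact hle y (by simpa using (hcap y hy).1) h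
    · rw [planeReflection_of_inner_eq he h.symm]
  obtain ⟨C, hC0, hC⟩ := hu.exists_lapl_sub_le hf (e := e) (l := l) (isCompact_closedBall c R)
    (fun y hy => (hcap y (by simpa [dist_eq_norm] using hy)).1)
    (fun y hy => hrefl y (by simpa [dist_eq_norm] using hy))
    (fun y hy => hWnn y (by simpa [dist_eq_norm] using hy))
  obtain ⟨ε, hε, h⟩ := exists_lower_bound_of_supersolution (c := c) (r := R / 2) (R := R) (w := W)
    (by linarith) (by linarith)
    (fun y hy => by
      have hy : ‖y - c‖ < R := by simpa [dist_eq_norm] using hy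
      exact (hu.contDiffAt (hcap y hy.le).1).sub (hu.contDiffAt_planeReflection (hrefl y hy.le)))
    (fun y hy => sub_nonneg.2 (hWnn y (by
      have hy : ‖y - c‖ < R := by simpa [dist_eq_norm] using hy
      exact hy.le)))
    hC0 (fun y hy => hC y (ball_subset_closedBall hy))
    (fun y hy => by
      have hy : ‖y - c‖ ≤ R / 2 := by simpa [dist_eq_norm] using hy
      exact sub_pos.2 (hlt y (by simpa using (hcap y (by linarith)).1) (hcap' y (by linarith))))
  have hder : HasDerivAt (fun t : ℝ => u (x + t • e) - u (x + t • (-e)))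
      (fderiv ℝ u x e - fderiv ℝ u x (-e)) 0 := by
    have hd : HasFDerivAt u (fderiv ℝ u x) x :=
      ((hu.contDiffAt hl1).differentiableAt (by norm_num)).hasFDerivAt
    have hline : ∀ v : 𝔼, HasDerivAt (fun t : ℝ => u (x + t • v)) (fderiv ℝ u x v) 0 := fun v =>
      hd.hasLineDerivAt v
    exact (hline e).sub (hline (-e))
  have hbound : ∀ᶠ t in 𝓝[>] (0 : ℝ),
      ε * R ≤ t⁻¹ • ((u (x + (0 + t) • e) - u (x + (0 + t) • (-e)))
        - (u (x + (0 : ℝ) • e) - u (x + (0 : ℝ) • (-e)))) := by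
    filter_upwards [self_mem_nhdsWithin, Ioo_mem_nhdsGT hR0] with t ht htR
    have ht0 : 0 < t := ht
    have hn : ‖x + t • e - c‖ = R - t := by
      rw [hc, hxe, ← add_smul, ← sub_smul, norm_smul, he, mul_one, Real.norm_eq_abs,
        abs_of_nonpos (by linarith [htR.2])]
      ring
    have h1 := h (x + t • e) (by rw [mem_ball, dist_eq_norm, hn]; linarith)
    rw [hn] at h1
    have h2 : planeReflection e l (x + t • e) = x + t • (-e) := by
      rw [planeReflection_eq he, hxe, ← add_smul, real_inner_smul_left, heI]
      module
    simp only [hW, h2] at h1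
    simp only [zero_add, zero_smul, add_zero, sub_self, sub_zero, smul_eq_mul]
    rw [inv_mul_eq_div, le_div_iff₀ ht0]
    have : ε * R * t ≤ ε * (R ^ 2 - (R - t) ^ 2) := by
      rw [mul_assoc]
      exact mul_le_mul_of_nonneg_left (by nlinarith [htR.2]) hε.le
    linarith
  have hlim := (hasDerivAt_iff_tendsto_slope_zero.1 hder).mono_left
    (nhdsWithin_mono (0 : ℝ) (fun t (ht : t ∈ Ioi 0) => (mem_Ioi.1 ht).ne'))
  have hfin := ge_of_tendsto hlim hbound
  rw [map_neg] at hfin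
  have : 0 < ε * R := by positivity
  linarith

/-- A large solution which is almost radially monotone near the boundary is radially symmetric
and radially increasing. -/
lemma IsLargeSolution.symmetry_of_almostRadiallyMonotone (hN : 1 ≤ N) {f : ℝ → ℝ}
    (hf : ContDiff ℝ 1 f) {u : 𝔼 → ℝ} (hu : IsLargeSolution f u)
    (hord : AlmostRadiallyMonotone u)
    {k : ℝ} (hk : 0 ≤ k) (hfk : ∀ s t, s ≤ t → f s - f t ≤ k * (t - s)) :
    (∃ w : ℝ → ℝ, ∀ x ∈ ball (0 : 𝔼) 1, u x = w ‖x‖) ∧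
    ∀ x ∈ ball (0 : 𝔼) 1, x ≠ 0 → 0 < fderiv ℝ u x (‖x‖⁻¹ • x) := by
  refine ⟨⟨fun r => u (EuclideanSpace.single ⟨0, hN⟩ r), fun x hx => ?_⟩,
    fun x hx hx0 => hu.fderiv_pos hf hord hk hfk hx hx0⟩
  have hn : ‖(EuclideanSpace.single ⟨0, hN⟩ ‖x‖ : 𝔼)‖ = ‖x‖ := by simp
  refine le_antisymm (hu.le_of_norm_eq hf hord hk hfk ?_ hn)
    (hu.le_of_norm_eq hf hord hk hfk hx hn.symm)
  rw [mem_ball_zero_iff] at hx ⊢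
  rwa [hn]

end Symmetry

section BlowUpODE

/-- The monotone operator whose fixed points are the inverse functions of decreasing solutions of
`U'' = g(t) f(U)` blowing up at `t = 0`. -/
noncomputable def travelTime (f g : ℝ → ℝ) (hg : Antitone g) (a M : ℝ) (C : ENNReal) (hC : C ≠ ⊤) :
    (ℝ → ENNReal) →o (ℝ → ENNReal) where
  toFun T u := ∫⁻ v in Ioi (max u M), ((2 * ∫⁻ w in Ioc a v,
    ENNReal.ofReal (f w) * ENNReal.ofReal (g (min (T w) C).toReal)) ^ (1 / 2 : ℝ))⁻¹
  monotone' T T' hT u := by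
    refine lintegral_mono fun v => ENNReal.inv_le_inv.2 (ENNReal.rpow_le_rpow ?_ (by norm_num))
    gcongr with w
    refine hg (ENNReal.toReal_mono ?_ (min_le_min_right _ (hT w)))
    exact ne_top_of_le_ne_top hC (min_le_right _ _)

/-- The implicit integral equation for the inverse function of a blowing-up solution of
`U'' = g(t) f(U)`. -/
lemma exists_travelTime {f : ℝ → ℝ} (hf : Continuous f) {a M : ℝ} (haM : a < M)
    (hfpos : ∀ t, a < t → 0 ≤ f t) (hF : ∀ t, a < t → 0 < ∫ s in a..t, f s)
    (hKO : IntegrableOn (fun t => 1 / Real.sqrt (∫ s in a..t, f s)) (Ici M))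
    {g : ℝ → ℝ} (hg : Antitone g) {g₀ : ℝ} (hg₀ : 0 < g₀) (hg₁ : ∀ t, g₀ ≤ g t) :
    ∃ τ : ℝ → ℝ, Antitone τ ∧
      (∀ v, a < v → 0 < ∫ w in a..v, g (τ w) * f w) ∧
      IntegrableOn (fun v => 1 / Real.sqrt (2 * ∫ w in a..v, g (τ w) * f w)) (Ioi M) ∧
      ∀ u, τ u = ∫ v in Ioi (max u M), 1 / Real.sqrt (2 * ∫ w in a..v, g (τ w) * f w) := by
  set F : ℝ → ℝ := fun t => ∫ s in a..t, f s with hFdef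
  have hKO' : IntegrableOn (fun t => 1 / Real.sqrt (2 * g₀) * (1 / Real.sqrt (F t))) (Ioi M) :=
    (hKO.mono_set Ioi_subset_Ici_self).const_mul _
  set C : ENNReal := ∫⁻ v in Ioi M, ENNReal.ofReal (1 / Real.sqrt (2 * g₀) * (1 / Real.sqrt (F v)))
    with hC
  have hCtop : C ≠ ⊤ := by
    have h := hKO'.lintegral_lt_top
    exact h.ne
  set T : ℝ → ENNReal := (travelTime f g hg a M C hCtop).lfp with hT
  have hTfix : ∀ u, T u = ∫⁻ v in Ioi (max u M), ((2 * ∫⁻ w in Ioc a v,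
      ENNReal.ofReal (f w) * ENNReal.ofReal (g (min (T w) C).toReal)) ^ (1 / 2 : ℝ))⁻¹ := fun u =>
    (congrFun (OrderHom.map_lfp (travelTime f g hg a M C hCtop)) u).symm
  have hTanti : Antitone T := fun u u' h => by
    rw [hTfix u, hTfix u']
    exact lintegral_mono_set (Ioi_subset_Ioi (max_le_max_right _ h))
  set τ : ℝ → ℝ := fun w => (min (T w) C).toReal with hτ
  have hτanti : Antitone τ := fun u u' h =>
    ENNReal.toReal_mono (ne_top_of_le_ne_top hCtop (min_le_right _ _))
      (min_le_min_right _ (hTanti h))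
  set Q : ℝ → ℝ := fun v => ∫ w in a..v, g (τ w) * f w with hQ
  have hint : ∀ x y, IntervalIntegrable (fun w => g (τ w) * f w) volume x y := fun x y =>
    ((hg.comp hτanti).intervalIntegrable).mul_continuousOn hf.continuousOn
  have hQF : ∀ v, a < v → g₀ * F v ≤ Q v := fun v hv => by
    rw [hFdef, hQ, ← intervalIntegral.integral_const_mul]
    refine intervalIntegral.integral_mono_on_of_le_Ioo hv.le
      ((hf.intervalIntegrable _ _).const_mul _) (hint _ _) fun w hw => ?_
    exact mul_le_mul_of_nonneg_right (hg₁ _) (hfpos w hw.1)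
  have hQpos : ∀ v, a < v → 0 < Q v := fun v hv =>
    (mul_pos hg₀ (hF v hv)).trans_le (hQF v hv)
  have hQc : Continuous Q := intervalIntegral.continuous_primitive hint a
  have hle : ∀ v ∈ Ioi M, 1 / Real.sqrt (2 * Q v)
      ≤ 1 / Real.sqrt (2 * g₀) * (1 / Real.sqrt (F v)) := fun v hv => by
    have hav : a < v := haM.trans hv
    rw [one_div_mul_one_div, ← Real.sqrt_mul (by positivity)]
    refine one_div_le_one_div_of_le (Real.sqrt_pos.2 (mul_pos (by positivity) (hF v hav)))
      (Real.sqrt_le_sqrt ?_)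
    have := hQF v hav
    linarith
  have hPint : IntegrableOn (fun v => 1 / Real.sqrt (2 * Q v)) (Ioi M) := by
    refine Integrable.mono' hKO' (Measurable.aestronglyMeasurable (by fun_prop)) ?_
    refine (ae_restrict_iff' measurableSet_Ioi).2 (Eventually.of_forall fun v hv => ?_)
    rw [Real.norm_of_nonneg (by positivity)]
    exact hle v hv
  have hTeq : ∀ u, T u = ∫⁻ v in Ioi (max u M), ENNReal.ofReal (1 / Real.sqrt (2 * Q v)) := by
    intro u
    rw [hTfix u]
    refine setLIntegral_congr_fun measurableSet_Ioi fun v hv => ?_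
    have hav : a < v := haM.trans ((le_max_right _ _).trans_lt hv)
    have h1 : ∫⁻ w in Ioc a v, ENNReal.ofReal (f w) * ENNReal.ofReal (g (min (T w) C).toReal)
        = ENNReal.ofReal (Q v) := by
      rw [hQ]
      simp only
      rw [intervalIntegral.integral_of_le hav.le, ofReal_integral_eq_lintegral_ofReal (hint a v).1]
      · refine setLIntegral_congr_fun measurableSet_Ioc fun w hw => ?_
        rw [← ENNReal.ofReal_mul (hfpos w hw.1), mul_comm]
      · refine (ae_restrict_iff' measurableSet_Ioc).2 (Eventually.of_forall fun w hw => ?_)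
        exact mul_nonneg (hg₀.le.trans (hg₁ _)) (hfpos w hw.1)
    have hP : 0 < Real.sqrt (2 * Q v) := Real.sqrt_pos.2 (mul_pos two_pos (hQpos v hav))
    rw [h1, show (2 : ENNReal) = ENNReal.ofReal 2 by simp, ← ENNReal.ofReal_mul two_pos.le,
      ENNReal.ofReal_rpow_of_pos (mul_pos two_pos (hQpos v hav)), ← Real.sqrt_eq_rpow,
      ← ENNReal.ofReal_inv_of_pos hP, one_div]
  have hTle : ∀ u, T u ≤ C := fun u => by
    rw [hTeq u, hC]
    refine (lintegral_mono_set (Ioi_subset_Ioi (le_max_right _ _))).trans ?_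
    exact setLIntegral_mono' measurableSet_Ioi fun v hv => ENNReal.ofReal_le_ofReal (hle v hv)
  refine ⟨τ, hτanti, hQpos, hPint, fun u => ?_⟩
  simp only [hτ]
  rw [min_eq_left (hTle u), hTeq u, integral_eq_lintegral_of_nonneg_ae
    (Eventually.of_forall fun v => by positivity)
    (hPint.mono_set (Ioi_subset_Ioi (le_max_right _ _))).aestronglyMeasurable]

lemma contDiffAt_two_of_hasDerivAt {V V₁ V₂ : ℝ → ℝ} {s : Set ℝ} (hs : IsOpen s)
    (h1 : ∀ t ∈ s, HasDerivAt V (V₁ t) t) (h2 : ∀ t ∈ s, HasDerivAt V₁ (V₂ t) t)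
    (hc : ContinuousOn V₂ s) {t : ℝ} (ht : t ∈ s) : ContDiffAt ℝ 2 V t := by
  have hd1 : ∀ t ∈ s, deriv V t = V₁ t := fun t ht => (h1 t ht).deriv
  have hd2 : ∀ t ∈ s, deriv V₁ t = V₂ t := fun t ht => (h2 t ht).deriv
  have hV₁ : ContDiffOn ℝ 1 V₁ s := by
    rw [show (1 : WithTop ℕ∞) = 0 + 1 from rfl, contDiffOn_succ_iff_deriv_of_isOpen hs]
    exact ⟨fun t ht => (h2 t ht).differentiableAt.differentiableWithinAt, by simp,
      contDiffOn_zero.2 (hc.congr hd2)⟩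
  have hV : ContDiffOn ℝ 2 V s := by
    rw [show (2 : WithTop ℕ∞) = 1 + 1 by norm_num, contDiffOn_succ_iff_deriv_of_isOpen hs]
    exact ⟨fun t ht => (h1 t ht).differentiableAt.differentiableWithinAt, by simp,
      hV₁.congr hd1⟩
  exact hV.contDiffAt (hs.mem_nhds ht)

/-- A decreasing solution of `U'' = g(t) f(U)` on a right neighbourhood of `0`, blowing up at `0`,
where `g` is a positive nonincreasing coefficient. -/
lemma exists_blowup_solution {f : ℝ → ℝ} (hf : Continuous f) {a M : ℝ} (haM : a < M)
    (hfpos : ∀ t, a < t → 0 ≤ f t) (hF : ∀ t, a < t → 0 < ∫ s in a..t, f s)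
    (hKO : IntegrableOn (fun t => 1 / Real.sqrt (∫ s in a..t, f s)) (Ici M))
    {g : ℝ → ℝ} (hg : Antitone g) (hgc : Continuous g) {g₀ : ℝ} (hg₀ : 0 < g₀)
    (hg₁ : ∀ t, g₀ ≤ g t) :
    ∃ t₁ > 0, ∃ U U₁ : ℝ → ℝ,
      (∀ t ∈ Ioo 0 t₁, a < U t ∧ HasDerivAt U (U₁ t) t ∧ HasDerivAt U₁ (g t * f (U t)) t) ∧
      AntitoneOn U (Ioo 0 t₁) ∧ Tendsto U (𝓝[>] 0) atTop := by
  obtain ⟨τ, hτanti, hQpos, hPint, hτeq⟩ := exists_travelTime hf haM hfpos hF hKO hg hg₀ hg₁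
  set Q : ℝ → ℝ := fun v => ∫ w in a..v, g (τ w) * f w with hQ
  have hint : ∀ x y, IntervalIntegrable (fun w => g (τ w) * f w) volume x y := fun x y =>
    ((hg.comp hτanti).intervalIntegrable).mul_continuousOn hf.continuousOn
  have hQc : Continuous Q := intervalIntegral.continuous_primitive hint a
  set p : ℝ → ℝ := fun v => 1 / Real.sqrt (2 * Q v) with hp
  have hPpos : ∀ v, a < v → 0 < Real.sqrt (2 * Q v) := fun v hv =>
    Real.sqrt_pos.2 (mul_pos two_pos (hQpos v hv))
  have hppos : ∀ v, a < v → 0 < p v := fun v hv => one_div_pos.2 (hPpos v hv)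
  have hpc : ∀ v, a < v → ContinuousAt p v := fun v hv =>
    continuousAt_const.div (by fun_prop) (hPpos v hv).ne'
  have hpII : ∀ u, M ≤ u → IntervalIntegrable p volume M u := fun u hu =>
    (intervalIntegrable_iff_integrableOn_Ioc_of_le hu).2 (hPint.mono_set Ioc_subset_Ioi_self)
  have hτM : ∀ u, M ≤ u → τ u = τ M - ∫ v in M..u, p v := fun u hu => by
    have h := intervalIntegral.integral_Ioi_sub_Ioi (f := p) (μ := volume) hPint hu
    rw [hτeq u, hτeq M, max_eq_left hu, max_self, ← h]
    ring
  have hder : ∀ u, M < u → HasDerivAt τ (-p u) u := fun u hu => by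
    have h1 : HasDerivAt (fun u => τ M - ∫ v in M..u, p v) (-p u) u := by
      refine (intervalIntegral.integral_hasDerivAt_right (hpII u hu.le) ?_
        (hpc u (haM.trans hu))).const_sub (τ M)
      exact (Measurable.stronglyMeasurable (by fun_prop)).stronglyMeasurableAtFilter
    refine h1.congr_of_eventuallyEq ?_
    filter_upwards [lt_mem_nhds hu] with v hv using hτM v hv.le
  have hanti : StrictAntiOn τ (Ici M) := by
    intro u hu v hv huv
    have hu' : M ≤ u := hu
    have hv' : M ≤ v := hv
    rw [hτM u hu, hτM v hv, ← intervalIntegral.integral_add_adjacent_intervals (hpII u hu)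
      ((hpII u hu).symm.trans (hpII v hv))]
    have : 0 < ∫ w in u..v, p w :=
      intervalIntegral.intervalIntegral_pos_of_pos_on ((hpII u hu).symm.trans (hpII v hv))
        (fun w hw => hppos w (haM.trans_le (hu'.trans hw.1.le))) huv
    linarith
  have hcont : ∀ v, M ≤ v → ContinuousOn τ (Icc M v) := fun v hv => by
    have h := intervalIntegral.continuousOn_primitive_interval' (hpII v hv) left_mem_uIcc
    rw [uIcc_of_le hv] at h
    exact (continuousOn_const.sub h).congr fun u hu => hτM u hu.1
  have hlim : Tendsto τ atTop (𝓝 0) := by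
    have h := intervalIntegral_tendsto_integral_Ioi M hPint tendsto_id
    have h2 := (tendsto_const_nhds (x := τ M)).sub h
    have h3 : τ M - ∫ v in Ioi M, p v = 0 := by
      rw [hτeq M, max_self, sub_self]
    rw [h3] at h2
    refine h2.congr' ?_
    filter_upwards [eventually_ge_atTop M] with u hu using (hτM u hu).symm
  have hτpos : ∀ u, M ≤ u → 0 < τ u := fun u hu => by
    have h1 : 0 ≤ τ (u + 1) := le_of_tendsto hlim (by
      filter_upwards [eventually_ge_atTop (u + 1)] with v hv using hτanti hv)
    exact h1.trans_lt (hanti hu (by show M ≤ u + 1; linarith) (by linarith))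
  have hsurj : ∀ t ∈ Ioo 0 (τ M), ∃ u, M < u ∧ τ u = t := by
    rintro t ⟨ht0, ht1⟩
    obtain ⟨v, hv, hMv⟩ := ((hlim.eventually (gt_mem_nhds ht0)).and (eventually_gt_atTop M)).exists
    obtain ⟨u, hu, hut⟩ := intermediate_value_Ioo' hMv.le (hcont v hMv.le) ⟨hv, ht1⟩
    exact ⟨u, hu.1, hut⟩
  choose! U hUM hUτ using hsurj
  have hUlt : ∀ t ∈ Ioo 0 (τ M), ∀ v, M ≤ v → (v < U t ↔ t < τ v) := fun t ht v hv => by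
    rw [← hanti.lt_iff_gt (hUM t ht).le hv, hUτ t ht]
  have hUgt : ∀ t ∈ Ioo 0 (τ M), ∀ v, M ≤ v → (U t < v ↔ τ v < t) := fun t ht v hv => by
    rw [← hanti.lt_iff_gt hv (hUM t ht).le, hUτ t ht]
  have hUc : ∀ t ∈ Ioo 0 (τ M), ContinuousAt U t := fun t ht => by
    have hnhds := isOpen_Ioo.mem_nhds ht
    refine tendsto_order.2 ⟨fun v hv => ?_, fun v hv => ?_⟩
    · have h1 : max v M < U t := max_lt hv (hUM t ht)
      filter_upwards [hnhds, gt_mem_nhds ((hUlt t ht _ (le_max_right _ _)).1 h1)] with s hs h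
      exact (le_max_left _ _).trans_lt ((hUlt s hs _ (le_max_right _ _)).2 h)
    · have hMv : M ≤ v := (hUM t ht).le.trans hv.le
      filter_upwards [hnhds, lt_mem_nhds ((hUgt t ht _ hMv).1 hv)] with s hs h
      exact (hUgt s hs _ hMv).2 h
  have hUder : ∀ t ∈ Ioo 0 (τ M), HasDerivAt U (-Real.sqrt (2 * Q (U t))) t := fun t ht => by
    have h := HasDerivAt.of_local_left_inverse (hUc t ht) (hder (U t) (hUM t ht))
      (neg_ne_zero.2 (hppos _ (haM.trans (hUM t ht))).ne')
      (by filter_upwards [isOpen_Ioo.mem_nhds ht] with s hs using hUτ s hs)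
    simpa [hp, inv_neg] using h
  have hQder : ∀ u, M < u → HasDerivAt Q (g (τ u) * f u) u := fun u hu => by
    refine intervalIntegral.integral_hasDerivAt_right (hint a u) ?_ ?_
    · exact ((hg.comp hτanti).measurable.mul hf.measurable).stronglyMeasurable
        |>.stronglyMeasurableAtFilter
    · exact (hgc.continuousAt.comp (hder u hu).continuousAt).mul hf.continuousAt
  refine ⟨τ M, hτpos M le_rfl, U, fun t => -Real.sqrt (2 * Q (U t)), fun t ht => ?_, ?_, ?_⟩
  · have haU : a < U t := haM.trans (hUM t ht)
    refine ⟨haU, hUder t ht, ?_⟩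
    have h1 := (((hQder (U t) (hUM t ht)).comp t (hUder t ht)).const_mul 2).sqrt
      (mul_pos two_pos (hQpos _ haU)).ne'
    have h2 := h1.neg
    rw [hUτ t ht] at h2
    have hP := (hPpos _ haU).ne'
    have h3 : g t * f (U t)
        = -(2 * (g t * f (U t) * -Real.sqrt (2 * Q (U t))) / (2 * Real.sqrt (2 * Q (U t)))) := by
      field_simp
    rw [h3]
    exact h2
  · intro s hs t ht hst
    by_contra! h
    have := (hUlt t ht _ (hUM s hs).le).1 h
    rw [hUτ s hs] at this
    linarith
  · refine tendsto_atTop.2 fun v => ?_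
    have hpos := hτpos (max v M) (le_max_right _ _)
    filter_upwards [Ioo_mem_nhdsGT hpos, Ioo_mem_nhdsGT (hτpos M le_rfl)] with t ht htM
    exact (le_max_left _ _).trans ((hUlt t htM _ (le_max_right _ _)).2 ht.2).le

end BlowUpODE

section RadialTime

/-- A decreasing change of the variable `q = ‖x‖ ^ 2` near `q = 1`, with `τ 1 = 0`, for which the
Laplacian of `V (τ (‖x‖ ^ 2))` in `ℝ^N` is `V'' / g`. -/
structure IsRadialTime (N : ℕ) (τ g : ℝ → ℝ) (g₀ C : ℝ) : Prop where
  strictAnti : StrictAnti τ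
  continuous : Continuous τ
  map_one : τ 1 = 0
  hasDerivAt : ∀ q ∈ Ioo (1 / 4 : ℝ) 1, HasDerivAt τ (-(1 / 2) * q ^ (-(N / 2) : ℝ)) q
  coeff_antitone : Antitone g
  coeff_continuous : Continuous g
  pos : 0 < g₀
  le_coeff : ∀ t, g₀ ≤ g t
  coeff_le_one : ∀ t, g t ≤ 1
  coeff_apply : ∀ q ∈ Ioo (1 / 4 : ℝ) 1, g (τ q) = q ^ (N - 1)
  rate_pos : 0 < C
  coeff_le_mul_exp : ∀ s t, s ≤ t → g s ≤ g t * Real.exp (C * (t - s))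

lemma exists_isRadialTime {N : ℕ} (hN : 1 ≤ N) : ∃ τ g g₀ C, IsRadialTime N τ g g₀ C := by
  set κ : ℝ → ℝ := fun s => min (max s (1 / 4)) 1 with hκ
  have hκc : Continuous κ := by rw [hκ]; fun_prop
  have hκ0 : ∀ s, 1 / 4 ≤ κ s := fun s => le_min (le_max_right _ _) (by norm_num)
  have hκ1 : ∀ s, κ s ≤ 1 := fun s => min_le_right _ _
  have hκpos : ∀ s, 0 < κ s := fun s => by linarith [hκ0 s]
  have hκmono : Monotone κ := fun s t h => min_le_min_right _ (max_le_max_right _ h)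
  have hκeq : ∀ q ∈ Ioo (1 / 4 : ℝ) 1, κ q = q := fun q hq => by
    simp only [hκ]
    rw [max_eq_left hq.1.le, min_eq_left hq.2.le]
  have hκadd : ∀ s d, 0 ≤ d → κ (s + d) ≤ κ s + d := fun s d hd => by
    simp only [hκ]
    rw [← min_add_add_right, ← max_add_add_right]
    exact min_le_min (max_le_max_left _ (by linarith)) (by linarith)
  set ρ : ℝ → ℝ := fun s => 1 / 2 * κ s ^ (-(N / 2) : ℝ) with hρ
  have hρc : Continuous ρ :=
    continuous_const.mul (hκc.rpow_const fun s => Or.inl (hκpos s).ne')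
  have hρ1 : ∀ s, 1 / 2 ≤ ρ s := fun s => by
    have : 1 ≤ κ s ^ (-(N / 2) : ℝ) :=
      Real.one_le_rpow_of_pos_of_le_one_of_nonpos (hκpos s) (hκ1 s) (by
        have : (0 : ℝ) ≤ N / 2 := by positivity
        linarith)
    simp only [hρ]
    linarith
  set m : ℝ → ℝ := fun q => ∫ s in 1..q, ρ s with hm
  have hmc : Continuous m :=
    intervalIntegral.continuous_primitive (fun x y => hρc.intervalIntegrable x y) 1
  have hmd : ∀ q, HasDerivAt m (ρ q) q := fun q =>
    intervalIntegral.integral_hasDerivAt_right (hρc.intervalIntegrable _ _)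
      (hρc.stronglyMeasurableAtFilter _ _) hρc.continuousAt
  have hgrow : ∀ s t, s ≤ t → 1 / 2 * (t - s) ≤ m t - m s := fun s t hst => by
    simp only [hm]
    rw [intervalIntegral.integral_interval_sub_left (hρc.intervalIntegrable _ _)
      (hρc.intervalIntegrable _ _)]
    have := intervalIntegral.integral_mono_on hst
      (intervalIntegrable_const (c := 1 / 2) (μ := volume))
      (hρc.intervalIntegrable s t) (fun x _ => hρ1 x)
    rw [intervalIntegral.integral_const, smul_eq_mul] at this
    linarith
  have hm1 : m 1 = 0 := intervalIntegral.integral_same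
  have hmmono : StrictMono m := fun s t hst => by
    have := hgrow s t hst.le
    linarith
  have hmsurj : Function.Surjective m := by
    refine hmc.surjective (tendsto_atTop.2 fun B => ?_) (tendsto_atBot.2 fun B => ?_)
    · filter_upwards [eventually_ge_atTop (max 1 (1 + 2 * B))] with q hq
      have := hgrow 1 q ((le_max_left _ _).trans hq)
      have := (le_max_right _ _).trans hq
      linarith
    · filter_upwards [eventually_le_atBot (min 1 (1 + 2 * B))] with q hq
      have := hgrow q 1 (hq.trans (min_le_left _ _))
      have := hq.trans (min_le_right _ _)
      linarith
  set E : ℝ ≃o ℝ := hmmono.orderIsoOfSurjective m hmsurj with hE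
  have hEm : ∀ q, E.symm (m q) = q := fun q => E.symm_apply_apply q
  have hmE : ∀ t, m (E.symm t) = t := fun t => E.apply_symm_apply t
  refine ⟨fun q => -m q, fun t => κ (E.symm (-t)) ^ (N - 1), (1 / 4) ^ (N - 1), 8 * N, ?_⟩
  refine ⟨fun s t h => neg_lt_neg (hmmono h), hmc.neg, by simp [hm1], fun q hq => ?_, ?_, ?_,
    by positivity, fun t => pow_le_pow_left₀ (by norm_num) (hκ0 _) _,
    fun t => pow_le_one₀ (hκpos _).le (hκ1 _), fun q hq => ?_, by positivity, ?_⟩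
  · have h := (hmd q).neg
    simp only [hρ, hκeq q hq] at h
    rwa [← neg_mul] at h
  · intro s t hst
    exact pow_le_pow_left₀ (hκpos _).le (hκmono (E.symm.monotone (neg_le_neg hst))) _
  · exact (hκc.comp (E.symm.continuous.comp continuous_neg)).pow _
  · simp only [neg_neg, hEm, hκeq q hq]
  · intro s t hst
    have h1 : E.symm (-t) ≤ E.symm (-s) := E.symm.monotone (neg_le_neg hst)
    have h2 := hgrow _ _ h1
    rw [hmE, hmE] at h2
    set y := E.symm (-t)
    have h3 : κ (E.symm (-s)) ≤ κ y + 2 * (t - s) :=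
      (hκmono (by linarith)).trans (hκadd y (2 * (t - s)) (by linarith))
    have h4 : κ (E.symm (-s)) ≤ κ y * Real.exp (8 * (t - s)) := by
      have := Real.add_one_le_exp (8 * (t - s))
      have := mul_le_mul_of_nonneg_left this (hκpos y).le
      nlinarith [hκ0 y]
    calc κ (E.symm (-s)) ^ (N - 1) ≤ (κ y * Real.exp (8 * (t - s))) ^ (N - 1) :=
          pow_le_pow_left₀ (hκpos _).le h4 _
      _ = κ y ^ (N - 1) * Real.exp (8 * (t - s)) ^ (N - 1) := mul_pow _ _ _
      _ ≤ κ y ^ (N - 1) * Real.exp (8 * N * (t - s)) := by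
          refine mul_le_mul_of_nonneg_left ?_ (pow_nonneg (hκpos y).le _)
          have h5 : 1 ≤ Real.exp (8 * (t - s)) := Real.one_le_exp (by linarith)
          refine (pow_le_pow_right₀ h5 (Nat.sub_le N 1)).trans (le_of_eq ?_)
          rw [← Real.exp_nat_mul]
          ring_nf

variable {N : ℕ}

local notation "𝔼" => EuclideanSpace ℝ (Fin N)

lemma IsRadialTime.contDiffAt {τ g : ℝ → ℝ} {g₀ C : ℝ} (h : IsRadialTime N τ g g₀ C) {q : ℝ}
    (hq : q ∈ Ioo (1 / 4 : ℝ) 1) : ContDiffAt ℝ 2 τ q := by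
  refine contDiffAt_two_of_hasDerivAt
    (V₂ := fun q => -(1 / 2) * (-(N / 2) * q ^ (-(N / 2) - 1 : ℝ))) isOpen_Ioo h.hasDerivAt
    (fun q hq => ?_) (fun q hq => ?_) hq
  · exact (Real.hasDerivAt_rpow_const (Or.inl (by linarith [hq.1]))).const_mul _
  · have : q ≠ 0 := by linarith [hq.1]
    exact (continuousAt_const.mul (continuousAt_const.mul
      (Real.continuousAt_rpow_const _ _ (Or.inl this)))).continuousWithinAt

lemma IsRadialTime.contDiffAt_comp {τ g : ℝ → ℝ} {g₀ C : ℝ} (h : IsRadialTime N τ g g₀ C)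
    {V : ℝ → ℝ} {x : 𝔼} (hx : ‖x‖ ^ 2 ∈ Ioo (1 / 4 : ℝ) 1)
    (hV : ContDiffAt ℝ 2 V (τ (‖x‖ ^ 2))) :
    ContDiffAt ℝ 2 (fun y : 𝔼 => V (τ (‖y‖ ^ 2))) x :=
  hV.comp x ((h.contDiffAt hx).comp x (contDiff_id.norm_sq ℝ).contDiffAt)

lemma IsRadialTime.lapl_comp (hN : 1 ≤ N) {τ g : ℝ → ℝ} {g₀ C : ℝ} (h : IsRadialTime N τ g g₀ C)
    {V V₁ : ℝ → ℝ} {V₂ : ℝ} {x : 𝔼} (hx : ‖x‖ ^ 2 ∈ Ioo (1 / 4 : ℝ) 1)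
    (hV : ContDiffAt ℝ 2 V (τ (‖x‖ ^ 2)))
    (h1 : ∀ᶠ t in 𝓝 (τ (‖x‖ ^ 2)), HasDerivAt V (V₁ t) t)
    (h2 : HasDerivAt V₁ V₂ (τ (‖x‖ ^ 2))) :
    lapl (fun y : 𝔼 => V (τ (‖y‖ ^ 2))) x = V₂ / g (τ (‖x‖ ^ 2)) := by
  set q := ‖x‖ ^ 2 with hq
  have hq0 : 0 < q := by linarith [hx.1]
  set p : ℝ → ℝ := fun q => -(1 / 2) * q ^ (-(N / 2) : ℝ) with hp
  have hp' : HasDerivAt p (-(1 / 2) * (-(N / 2) * q ^ (-(N / 2) - 1 : ℝ))) q :=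
    (Real.hasDerivAt_rpow_const (Or.inl hq0.ne')).const_mul _
  have key := lapl_comp_normSq (G := fun s => V (τ s)) (G1 := fun s => V₁ (τ s) * p s)
    (G2 := V₂ * p q * p q + V₁ (τ q) * (-(1 / 2) * (-(N / 2) * q ^ (-(N / 2) - 1 : ℝ)))) (0 : 𝔼) x
    (by rw [sub_zero]; exact hV.comp _ (h.contDiffAt hx))
    (by
      rw [sub_zero, ← hq]
      filter_upwards [isOpen_Ioo.mem_nhds hx, h.continuous.continuousAt.eventually h1]
        with s hs h1 using h1.comp s (h.hasDerivAt s hs))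
    (by
      rw [sub_zero, ← hq]
      exact (h2.comp q (h.hasDerivAt q hx)).mul hp')
  simp only [sub_zero] at key
  rw [key, h.coeff_apply q hx, ← hq]
  have e1 : q ^ (-(N / 2) - 1 : ℝ) = q ^ (-(N / 2) : ℝ) / q := Real.rpow_sub_one hq0.ne' _
  have e2 : q ^ (-(N / 2) : ℝ) * q ^ (-(N / 2) : ℝ) = (q ^ (N - 1) * q)⁻¹ := by
    rw [← Real.rpow_add hq0, ← pow_succ, Nat.sub_add_cancel hN, ← Real.rpow_natCast,
      ← Real.rpow_neg hq0.le]
    congr 1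
    ring
  simp only [hp, e1]
  set z := q ^ (-(N / 2) : ℝ)
  have hpow : q ^ (N - 1) ≠ 0 := (pow_pos hq0 _).ne'
  have e3 : 4 * q * (V₂ * (-(1 / 2) * z) * (-(1 / 2) * z)
      + V₁ (τ q) * (-(1 / 2) * (-(N / 2) * (z / q)))) + 2 * N * (V₁ (τ q) * (-(1 / 2) * z))
      = q * V₂ * (z * z) := by
    field_simp
    ring
  rw [e3, e2]
  field_simp

end RadialTime

section BoundaryAsymptotics

variable {N : ℕ}

local notation "𝔼" => EuclideanSpace ℝ (Fin N)

/-- The concave function `1 - exp (-b t)`, used as a barrier. -/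
noncomputable def barrier (b t : ℝ) : ℝ := 1 - Real.exp (-b * t)

lemma barrier_lt_one (b t : ℝ) : barrier b t < 1 := by
  have := Real.exp_pos (-b * t)
  unfold barrier
  linarith

lemma barrier_mono {b : ℝ} (hb : 0 ≤ b) : Monotone (barrier b) := fun s t h => by
  have : Real.exp (-b * t) ≤ Real.exp (-b * s) := Real.exp_le_exp.2 (by nlinarith)
  unfold barrier
  linarith

lemma barrier_zero (b : ℝ) : barrier b 0 = 0 := by simp [barrier]

lemma barrier_pos {b t : ℝ} (hb : 0 < b) (ht : 0 < t) : 0 < barrier b t := by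
  have : Real.exp (-b * t) < Real.exp 0 := Real.exp_lt_exp.2 (by nlinarith)
  rw [Real.exp_zero] at this
  unfold barrier
  linarith

lemma barrier_nonneg {b t : ℝ} (hb : 0 ≤ b) (ht : 0 ≤ t) : 0 ≤ barrier b t :=
  barrier_zero b ▸ barrier_mono hb ht

lemma contDiff_barrier (b : ℝ) : ContDiff ℝ 2 (barrier b) := by
  unfold barrier
  fun_prop

lemma hasDerivAt_barrier (b t : ℝ) : HasDerivAt (barrier b) (b * Real.exp (-b * t)) t := by
  have h := (((hasDerivAt_id t).const_mul (-b)).exp).const_sub 1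
  refine h.congr_deriv ?_
  simp only [id, mul_one]
  ring

lemma hasDerivAt_barrier_deriv (b t : ℝ) :
    HasDerivAt (fun t => b * Real.exp (-b * t)) (-(b ^ 2 * Real.exp (-b * t))) t := by
  have h := (((hasDerivAt_id t).const_mul (-b)).exp).const_mul b
  refine h.congr_deriv ?_
  simp only [id, mul_one]
  ring

lemma IsRadialTime.lapl_barrier_lt (hN : 1 ≤ N) {τ g : ℝ → ℝ} {g₀ C : ℝ}
    (h : IsRadialTime N τ g g₀ C) {k b : ℝ} (hk : 0 ≤ k) (hb : b = 3 * (k + 1)) {x : 𝔼}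
    (hx : ‖x‖ ^ 2 ∈ Ioo (1 / 4 : ℝ) 1) (ht : b * τ (‖x‖ ^ 2) ≤ 1) :
    lapl (fun y : 𝔼 => barrier b (τ (‖y‖ ^ 2))) x < -(2 * k) := by
  rw [h.lapl_comp hN hx (contDiff_barrier b).contDiffAt
    (Eventually.of_forall fun t => hasDerivAt_barrier b t) (hasDerivAt_barrier_deriv b _)]
  have h1 := exp_barrier_inequality hk hb ht
  have hg0 : 0 < g (τ (‖x‖ ^ 2)) := h.pos.trans_le (h.le_coeff _)
  rw [div_lt_iff₀ hg0]
  nlinarith [h.coeff_le_one (τ (‖x‖ ^ 2))]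

/-- Comparison of a subsolution and a supersolution, up to a multiple of the barrier. -/
lemma IsRadialTime.le_add_barrier (hN : 1 ≤ N) {τ g : ℝ → ℝ} {g₀ C : ℝ}
    (h : IsRadialTime N τ g g₀ C) {f : ℝ → ℝ} {k b : ℝ} (hk : 0 ≤ k) (hb : b = 3 * (k + 1))
    (hfk : ∀ s t, s ≤ t → f s - f t ≤ k * (t - s)) {Ω : Set 𝔼} (hΩ : IsOpen Ω)
    (hΩ1 : ∀ x ∈ Ω, ‖x‖ ^ 2 ∈ Ioo (1 / 4 : ℝ) 1) (hΩt : ∀ x ∈ Ω, b * τ (‖x‖ ^ 2) ≤ 1)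
    {v w : 𝔼 → ℝ} (hv : ∀ x ∈ Ω, ContDiffAt ℝ 2 v x) (hw : ∀ x ∈ Ω, ContDiffAt ℝ 2 w x)
    (hfv : ∀ x ∈ Ω, f (v x) ≤ lapl v x) (hfw : ∀ x ∈ Ω, lapl w x ≤ f (w x))
    {A : ℝ} (hA : 0 ≤ A)
    (hbd : ∀ x₀ ∈ closure Ω, x₀ ∉ Ω →
      ∀ᶠ x in 𝓝[Ω] x₀, v x ≤ w x + A * barrier b (τ (‖x‖ ^ 2))) :
    ∀ x ∈ Ω, v x ≤ w x + A * barrier b (τ (‖x‖ ^ 2)) := by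
  have hb0 : 0 < b := by rw [hb]; positivity
  have hτ0 : ∀ x ∈ Ω, 0 ≤ τ (‖x‖ ^ 2) := fun x hx =>
    h.map_one ▸ h.strictAnti.antitone (hΩ1 x hx).2.le
  have hHc : ∀ x ∈ Ω, ContDiffAt ℝ 2 (fun y : 𝔼 => barrier b (τ (‖y‖ ^ 2))) x := fun x hx =>
    h.contDiffAt_comp (hΩ1 x hx) (contDiff_barrier b).contDiffAt
  have hmain : ∀ x ∈ Ω, 0 ≤ w x - v x + A * barrier b (τ (‖x‖ ^ 2)) := by
    refine nonneg_of_lapl_mul_lt (φ := fun x => 1 + barrier b (τ (‖x‖ ^ 2))) hΩ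
      (isBounded_ball.subset (s := Ω) (t := ball (0 : 𝔼) 1) fun x hx => ?_)
      (fun x hx => ((hw x hx).sub (hv x hx)).add (contDiffAt_const.mul (hHc x hx)))
      (fun x hx => contDiffAt_const.add (hHc x hx))
      (fun x hx => by
        have := barrier_nonneg hb0.le (hτ0 x hx)
        linarith) ?_ ?_
    · have h1 := (hΩ1 x hx).2
      rw [mem_ball_zero_iff]
      nlinarith [norm_nonneg x]
    · intro x₀ hx₀ hx₀Ω ε hε
      filter_upwards [hbd x₀ hx₀ hx₀Ω] with x hx
      linarith
    · intro x hx hneg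
      rw [lapl_add ((hw x hx).sub (hv x hx)) (contDiffAt_const.mul (hHc x hx)),
        lapl_sub (hw x hx) (hv x hx), lapl_const_mul _ (hHc x hx),
        lapl_add contDiffAt_const (hHc x hx)]
      have h0 : lapl (fun _ : 𝔼 => (1 : ℝ)) x = 0 := by simp [lapl_eq_laplacian]
      rw [h0, zero_add]
      have hlap := h.lapl_barrier_lt hN hk hb (hΩ1 x hx) (hΩt x hx)
      have hH0 := barrier_nonneg hb0.le (hτ0 x hx)
      have hH1 := barrier_lt_one b (τ (‖x‖ ^ 2))
      have h1 := hfv x hx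
      have h2 := hfw x hx
      set H := barrier b (τ (‖x‖ ^ 2))
      set L := lapl (fun y : 𝔼 => barrier b (τ (‖y‖ ^ 2))) x
      have hAH : 0 ≤ A * H := mul_nonneg hA hH0
      have h3 := hfk (w x) (v x) (by linarith)
      set W := w x - v x + A * H with hW
      have h4 : A * (k * H + L) ≤ 0 := mul_nonpos_of_nonneg_of_nonpos hA (by nlinarith)
      have h5 : lapl w x - lapl v x + A * L ≤ -(k * W) := by
        have : k * W = k * (w x - v x) + A * (k * H) := by rw [hW]; ring
        linarith
      have h6 : (lapl w x - lapl v x + A * L) * (1 + H) ≤ -(k * W) * (1 + H) :=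
        mul_le_mul_of_nonneg_right h5 (by linarith)
      have h7 : -(k * W) * (1 + H) ≤ -(k * W) * 2 :=
        mul_le_mul_of_nonneg_left (by linarith) (by nlinarith)
      nlinarith
  intro x hx
  linarith [hmain x hx]

/-- A blowing-up solution of the radial equation written in the radial time. -/
structure IsBlowUpSolution (f g U U₁ : ℝ → ℝ) (a t₁ : ℝ) : Prop where
  pos : 0 < t₁
  lt : ∀ t ∈ Ioo 0 t₁, a < U t
  hasDerivAt : ∀ t ∈ Ioo 0 t₁, HasDerivAt U (U₁ t) t
  hasDerivAt' : ∀ t ∈ Ioo 0 t₁, HasDerivAt U₁ (g t * f (U t)) t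
  antitoneOn : AntitoneOn U (Ioo 0 t₁)
  tendsto : Tendsto U (𝓝[>] 0) atTop

lemma IsBlowUpSolution.lapl_rescale (hN : 1 ≤ N) {τ g : ℝ → ℝ} {g₀ C : ℝ}
    (h : IsRadialTime N τ g g₀ C) {f U U₁ : ℝ → ℝ} (hf : Continuous f) {a t₁ : ℝ}
    (hU : IsBlowUpSolution f g U U₁ a t₁) (κ s : ℝ) {x : 𝔼}
    (hx : ‖x‖ ^ 2 ∈ Ioo (1 / 4 : ℝ) 1) (ht : κ * τ (‖x‖ ^ 2) + s ∈ Ioo 0 t₁) :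
    ContDiffAt ℝ 2 (fun y : 𝔼 => U (κ * τ (‖y‖ ^ 2) + s)) x ∧
    lapl (fun y : 𝔼 => U (κ * τ (‖y‖ ^ 2) + s)) x = κ ^ 2 * g (κ * τ (‖x‖ ^ 2) + s)
      * f (U (κ * τ (‖x‖ ^ 2) + s)) / g (τ (‖x‖ ^ 2)) := by
  set D : Set ℝ := {t | κ * t + s ∈ Ioo 0 t₁} with hD
  have hDo : IsOpen D := isOpen_Ioo.preimage (by fun_prop)
  have haff : ∀ t, HasDerivAt (fun t => κ * t + s) κ t := fun t => by
    simpa using ((hasDerivAt_id t).const_mul κ).add_const s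
  have h1 : ∀ t ∈ D, HasDerivAt (fun t => U (κ * t + s)) (U₁ (κ * t + s) * κ) t := fun t ht =>
    (hU.hasDerivAt _ ht).comp t (haff t)
  have h2 : ∀ t ∈ D, HasDerivAt (fun t => U₁ (κ * t + s) * κ)
      (g (κ * t + s) * f (U (κ * t + s)) * κ * κ) t := fun t ht =>
    ((hU.hasDerivAt' _ ht).comp t (haff t)).mul_const κ
  have hc : ContDiffAt ℝ 2 (fun t => U (κ * t + s)) (τ (‖x‖ ^ 2)) := by
    refine contDiffAt_two_of_hasDerivAt hDo h1 h2 (fun t ht => ?_) ht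
    have hUc := (h1 t ht).continuousAt
    have hgc := h.coeff_continuous
    exact ((((hgc.continuousAt.comp (haff t).continuousAt).mul
      (hf.continuousAt.comp hUc)).mul continuousAt_const).mul
        continuousAt_const).continuousWithinAt
  refine ⟨h.contDiffAt_comp hx hc, ?_⟩
  rw [h.lapl_comp hN hx hc (by filter_upwards [hDo.mem_nhds ht] with t ht using h1 t ht)
    (h2 _ ht)]
  congr 1
  ring

lemma IsRadialTime.sq_mul_coeff_le {τ g : ℝ → ℝ} {g₀ C : ℝ} (h : IsRadialTime N τ g g₀ C)
    {σ t : ℝ} (hσ : 0 ≤ σ) (hσ1 : 2 * C * σ ≤ 1) (ht : 0 ≤ t) (ht1 : 2 * C * t ≤ 1) :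
    (1 - 2 * C * σ) ^ 2 * g ((1 - 2 * C * σ) * t + -σ) ≤ g t := by
  have hC := h.rate_pos
  have hle : (1 - 2 * C * σ) * t + -σ ≤ t := by
    have : 0 ≤ 2 * C * σ * t := by positivity
    linarith
  have h1 := h.coeff_le_mul_exp _ _ hle
  have h2 : (1 - 2 * C * σ) ^ 2 ≤ Real.exp (-(4 * C * σ)) := by
    have e : Real.exp (-(4 * C * σ)) = Real.exp (-(2 * C * σ)) ^ 2 := by
      rw [← Real.exp_nat_mul]; push_cast; ring_nf
    rw [e]
    exact pow_le_pow_left₀ (by linarith) (by linarith [Real.add_one_le_exp (-(2 * C * σ))]) 2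
  have hg0 : 0 < g t := h.pos.trans_le (h.le_coeff _)
  have hg1 : 0 ≤ g ((1 - 2 * C * σ) * t + -σ) := h.pos.le.trans (h.le_coeff _)
  calc _ ≤ Real.exp (-(4 * C * σ)) *
        (g t * Real.exp (C * (t - ((1 - 2 * C * σ) * t + -σ)))) :=
        mul_le_mul h2 h1 hg1 (Real.exp_pos _).le
    _ = g t * Real.exp (-(4 * C * σ) + C * (t - ((1 - 2 * C * σ) * t + -σ))) := by
        rw [Real.exp_add]; ring
    _ ≤ g t * 1 := by
        refine mul_le_mul_of_nonneg_left (Real.exp_le_one_iff.2 ?_) hg0.le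
        have : C * σ * (2 * C * t) ≤ C * σ * 1 :=
          mul_le_mul_of_nonneg_left ht1 (by positivity)
        have : 0 ≤ C * σ := by positivity
        nlinarith
    _ = g t := mul_one _

lemma IsRadialTime.le_sq_mul_coeff {τ g : ℝ → ℝ} {g₀ C : ℝ} (h : IsRadialTime N τ g g₀ C)
    {σ t : ℝ} (hσ : 0 ≤ σ) (hσ1 : 4 * C * σ ≤ 1) (ht : 0 ≤ t) (ht1 : 2 * C * t ≤ 1) :
    g t ≤ (1 + 2 * C * σ) ^ 2 * g ((1 + 2 * C * σ) * t + σ) := by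
  have hC := h.rate_pos
  have hCσ : 0 ≤ C * σ := by positivity
  have hle : t ≤ (1 + 2 * C * σ) * t + σ := by
    have : 0 ≤ 2 * C * σ * t := by positivity
    linarith
  have h1 := h.coeff_le_mul_exp _ _ hle
  have hg0 : 0 ≤ g ((1 + 2 * C * σ) * t + σ) := h.pos.le.trans (h.le_coeff _)
  refine h1.trans ((mul_comm _ _).le.trans (mul_le_mul_of_nonneg_right ?_ hg0))
  have h2 : C * ((1 + 2 * C * σ) * t + σ - t) ≤ 2 * C * σ := by
    have : C * σ * (2 * C * t) ≤ C * σ * 1 := mul_le_mul_of_nonneg_left ht1 hCσ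
    nlinarith
  refine (Real.exp_le_exp.2 h2).trans ?_
  set y := 2 * C * σ
  have hy0 : 0 ≤ y := by positivity
  have hy1 : y ≤ 1 / 2 := by simp only [y]; linarith
  have h3 : (1 - y) * Real.exp y ≤ 1 := by
    have := Real.one_sub_le_exp_neg y
    have h4 : Real.exp (-y) * Real.exp y = 1 := by rw [← Real.exp_add]; simp
    nlinarith [Real.exp_pos y]
  have h5 : 1 ≤ (1 - y) * (1 + y) ^ 2 := by nlinarith [mul_nonneg hy0 hy0]
  have h6 : (1 - y) * Real.exp y ≤ (1 - y) * (1 + y) ^ 2 := h3.trans h5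
  exact le_of_mul_le_mul_left h6 (by linarith)

end BoundaryAsymptotics

section BoundaryComparison

variable {N : ℕ}

local notation "𝔼" => EuclideanSpace ℝ (Fin N)

lemma IsRadialTime.continuous_norm_sq {τ g : ℝ → ℝ} {g₀ C : ℝ} (h : IsRadialTime N τ g g₀ C) :
    Continuous fun x : 𝔼 => τ (‖x‖ ^ 2) :=
  h.continuous.comp (by fun_prop)

lemma IsRadialTime.norm_lt_one {τ g : ℝ → ℝ} {g₀ C : ℝ} (h : IsRadialTime N τ g g₀ C) {x : 𝔼}
    (hx : 0 < τ (‖x‖ ^ 2)) : ‖x‖ < 1 := by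
  rw [← h.map_one, h.strictAnti.lt_iff_gt] at hx
  nlinarith [norm_nonneg x]

lemma IsRadialTime.norm_sq_mem {τ g : ℝ → ℝ} {g₀ C : ℝ} (h : IsRadialTime N τ g g₀ C) {x : 𝔼}
    (hx : 0 < τ (‖x‖ ^ 2)) (hx' : τ (‖x‖ ^ 2) < τ (1 / 4)) : ‖x‖ ^ 2 ∈ Ioo (1 / 4 : ℝ) 1 := by
  rw [← h.map_one, h.strictAnti.lt_iff_gt] at hx
  rw [h.strictAnti.lt_iff_gt] at hx'
  exact ⟨hx', hx⟩

lemma IsLargeSolution.exists_bound_of_radialTime {f : ℝ → ℝ} {u : 𝔼 → ℝ}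
    (hu : IsLargeSolution f u) {τ g : ℝ → ℝ} {g₀ C : ℝ} (h : IsRadialTime N τ g g₀ C)
    {t₀ : ℝ} (ht₀ : 0 < t₀) :
    ∃ B, ∀ x : 𝔼, t₀ / 2 ≤ τ (‖x‖ ^ 2) → τ (‖x‖ ^ 2) ≤ t₀ → |u x| ≤ B := by
  have hS : IsCompact {x : 𝔼 | τ (‖x‖ ^ 2) ∈ Icc (t₀ / 2) t₀} := by
    refine (isCompact_closedBall (0 : 𝔼) 1).of_isClosed_subset
      (isClosed_Icc.preimage h.continuous_norm_sq) fun x hx => ?_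
    rw [mem_closedBall_zero_iff]
    exact (h.norm_lt_one (lt_of_lt_of_le (by positivity) hx.1)).le
  obtain ⟨B, hB⟩ := hS.exists_bound_of_continuousOn (f := u) fun x hx =>
    (hu.contDiffAt (h.norm_lt_one
      (lt_of_lt_of_le (by positivity) hx.1))).continuousAt.continuousWithinAt
  exact ⟨B, fun x hx hx' => hB x ⟨hx, hx'⟩⟩

lemma exists_le_mul_barrier {b t₀ : ℝ} (hb : 0 < b) (ht₀ : 0 < t₀) (B : ℝ) :
    ∃ A ≥ 0, ∀ t, t₀ / 2 ≤ t → B ≤ A * barrier b t := by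
  have hH := barrier_pos hb (half_pos ht₀)
  refine ⟨|B| / barrier b (t₀ / 2), by positivity, fun t ht => (le_abs_self B).trans ?_⟩
  rw [div_mul_eq_mul_div, le_div_iff₀ hH]
  exact mul_le_mul_of_nonneg_left (barrier_mono hb.le ht) (abs_nonneg B)

lemma IsLargeSolution.le_blowUpSolution_add_barrier (hN : 1 ≤ N) {f : ℝ → ℝ} {u : 𝔼 → ℝ}
    (hf : Continuous f) (hu : IsLargeSolution f u) {τ g : ℝ → ℝ} {g₀ C : ℝ}
    (h : IsRadialTime N τ g g₀ C) {k b : ℝ} (hk : 0 ≤ k) (hb : b = 3 * (k + 1))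
    (hfk : ∀ s t, s ≤ t → f s - f t ≤ k * (t - s)) {U U₁ : ℝ → ℝ} {a t₁ t₀ : ℝ}
    (hfpos : ∀ t, a < t → 0 ≤ f t)
    (hU : IsBlowUpSolution f g U U₁ a t₁) (ht₀ : 0 < t₀) (hbt₀ : b * t₀ ≤ 1)
    (hCt₀ : 2 * C * t₀ ≤ 1) (ht₀₁ : t₀ < t₁) (ht₀τ : t₀ < τ (1 / 4)) :
    ∃ A ≥ 0, ∀ x : 𝔼, 0 < τ (‖x‖ ^ 2) → τ (‖x‖ ^ 2) < t₀ →
      u x ≤ U (τ (‖x‖ ^ 2)) + A * barrier b (τ (‖x‖ ^ 2)) := by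
  have hb0 : 0 < b := by rw [hb]; positivity
  have hC := h.rate_pos
  have hτc := h.continuous_norm_sq
  obtain ⟨B, hB⟩ := hu.exists_bound_of_radialTime h ht₀
  obtain ⟨A, hA, hAB⟩ := exists_le_mul_barrier hb0 ht₀ (B - a)
  refine ⟨A, hA, fun x hx hxt => ?_⟩
  have hσ : ∀ σ > 0, 2 * C * σ < 1 → 0 < (1 - 2 * C * σ) * τ (‖x‖ ^ 2) + -σ →
      u x ≤ U ((1 - 2 * C * σ) * τ (‖x‖ ^ 2) + -σ) + A * barrier b (τ (‖x‖ ^ 2)) := by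
    intro σ hσ hσC hσx
    set κ := 1 - 2 * C * σ with hκ
    have hκ0 : 0 < κ := by linarith
    have hκ1 : κ ≤ 1 := by
      have : 0 ≤ 2 * C * σ := by positivity
      linarith
    have htpos : ∀ t, 0 ≤ κ * t + -σ → 0 < t := fun t ht => by
      by_contra! hneg
      nlinarith
    have hmem : ∀ t, 0 < κ * t + -σ → t < t₀ → κ * t + -σ ∈ Ioo 0 t₁ := fun t ht ht' =>
      ⟨ht, by nlinarith [htpos t ht.le]⟩
    have hκc : Continuous fun x : 𝔼 => κ * τ (‖x‖ ^ 2) + -σ :=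
      (continuous_const.mul hτc).add continuous_const
    set Ω : Set 𝔼 := {x | 0 < κ * τ (‖x‖ ^ 2) + -σ ∧ τ (‖x‖ ^ 2) < t₀} with hΩ
    have hΩo : IsOpen Ω :=
      (isOpen_lt continuous_const hκc).inter (isOpen_lt hτc continuous_const)
    have hΩq : ∀ y ∈ Ω, ‖y‖ ^ 2 ∈ Ioo (1 / 4 : ℝ) 1 := fun y hy =>
      h.norm_sq_mem (htpos _ hy.1.le) (hy.2.trans ht₀τ)
    have hΩ1 : ∀ y ∈ Ω, ‖y‖ < 1 := fun y hy => h.norm_lt_one (htpos _ hy.1.le)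
    refine h.le_add_barrier hN hk hb hfk (Ω := Ω)
      (w := fun y => U (κ * τ (‖y‖ ^ 2) + -σ)) hΩo hΩq
      (fun y hy => (mul_le_mul_of_nonneg_left hy.2.le hb0.le).trans hbt₀)
      (fun y hy => hu.contDiffAt (hΩ1 y hy))
      (fun y hy => (hU.lapl_rescale hN h hf κ (-σ) (hΩq y hy) (hmem _ hy.1 hy.2)).1)
      (fun y hy => (hu.2.1 y (by simpa using hΩ1 y hy)).ge) (fun y hy => ?_) hA ?_ x ⟨hσx, hxt⟩
    · rw [(hU.lapl_rescale hN h hf κ (-σ) (hΩq y hy) (hmem _ hy.1 hy.2)).2,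
        div_le_iff₀ (h.pos.trans_le (h.le_coeff _)), mul_comm (f _)]
      refine mul_le_mul_of_nonneg_right ?_ (hfpos _ (hU.lt _ (hmem _ hy.1 hy.2)))
      have hy0 := htpos _ hy.1.le
      exact h.sq_mul_coeff_le hσ.le hσC.le hy0.le
        ((mul_le_mul_of_nonneg_left hy.2.le (by positivity)).trans hCt₀)
    · intro x₀ hx₀ hx₀Ω
      have h1 : 0 ≤ κ * τ (‖x₀‖ ^ 2) + -σ :=
        closure_lt_subset_le continuous_const hκc (closure_mono (fun y hy => hy.1) hx₀)
      have h2 : τ (‖x₀‖ ^ 2) ≤ t₀ :=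
        closure_lt_subset_le hτc continuous_const (closure_mono (fun y hy => hy.2) hx₀)
      rcases h2.lt_or_eq with h2 | h2
      · have h3 : κ * τ (‖x₀‖ ^ 2) + -σ = 0 :=
          le_antisymm (not_lt.1 fun h3 => hx₀Ω ⟨h3, h2⟩) h1
        have hlim : Tendsto (fun y : 𝔼 => κ * τ (‖y‖ ^ 2) + -σ) (𝓝[Ω] x₀) (𝓝[>] 0) := by
          refine tendsto_nhdsWithin_iff.2 ⟨?_, ?_⟩
          · exact h3 ▸ (hκc.tendsto x₀).mono_left nhdsWithin_le_nhds
          · filter_upwards [self_mem_nhdsWithin] with y hy using hy.1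
        have hux : ∀ᶠ y in 𝓝[Ω] x₀, u y < u x₀ + 1 :=
          ((hu.contDiffAt (h.norm_lt_one (htpos _ h1))).continuousAt.eventually
            (gt_mem_nhds (lt_add_one _))).filter_mono nhdsWithin_le_nhds
        filter_upwards [hux, (hU.tendsto.comp hlim).eventually_ge_atTop (u x₀ + 1),
          self_mem_nhdsWithin] with y h4 h5 h6
        have h7 := mul_nonneg hA (barrier_nonneg hb0.le (htpos _ h6.1.le).le)
        simp only [Function.comp] at h5
        linarith
      · have hev : ∀ᶠ y in 𝓝[Ω] x₀, t₀ / 2 < τ (‖y‖ ^ 2) :=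
          (hτc.continuousAt.eventually (lt_mem_nhds
            (by show t₀ / 2 < τ (‖x₀‖ ^ 2); rw [h2]; linarith))).filter_mono
            nhdsWithin_le_nhds
        filter_upwards [hev, self_mem_nhdsWithin] with y h4 h5
        have h6 := (abs_le.1 (hB y h4.le h5.2.le)).2
        have h7 := hAB _ h4.le
        have h8 := hU.lt _ (hmem _ h5.1 h5.2)
        linarith
  have hlim0 : Tendsto (fun σ : ℝ => (1 - 2 * C * σ) * τ (‖x‖ ^ 2) + -σ) (𝓝[>] 0)
      (𝓝 (τ (‖x‖ ^ 2))) := by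
    have : Continuous fun σ : ℝ => (1 - 2 * C * σ) * τ (‖x‖ ^ 2) + -σ := by fun_prop
    have h1 := this.tendsto 0
    simp only [mul_zero, sub_zero, one_mul, neg_zero, add_zero] at h1
    exact h1.mono_left nhdsWithin_le_nhds
  have hUc : ContinuousAt U (τ (‖x‖ ^ 2)) := (hU.hasDerivAt _ ⟨hx, hxt.trans ht₀₁⟩).continuousAt
  refine ge_of_tendsto ((hUc.tendsto.comp hlim0).add_const _) ?_
  have hsmall : ∀ᶠ σ in 𝓝[>] (0 : ℝ), 2 * C * σ < 1 := by
    have : Continuous fun σ : ℝ => 2 * C * σ := by fun_prop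
    exact (this.continuousAt.eventually (gt_mem_nhds (by simp))).filter_mono nhdsWithin_le_nhds
  filter_upwards [self_mem_nhdsWithin, hsmall, hlim0.eventually (lt_mem_nhds hx)]
    with σ h1 h2 h3 using hσ σ h1 h2 h3

lemma IsLargeSolution.blowUpSolution_le_add_barrier (hN : 1 ≤ N) {f : ℝ → ℝ} {u : 𝔼 → ℝ}
    (hf : Continuous f) (hu : IsLargeSolution f u) {τ g : ℝ → ℝ} {g₀ C : ℝ}
    (h : IsRadialTime N τ g g₀ C) {k b : ℝ} (hk : 0 ≤ k) (hb : b = 3 * (k + 1))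
    (hfk : ∀ s t, s ≤ t → f s - f t ≤ k * (t - s)) {U U₁ : ℝ → ℝ} {a t₁ t₀ : ℝ}
    (hfpos : ∀ t, a < t → 0 ≤ f t)
    (hU : IsBlowUpSolution f g U U₁ a t₁) (ht₀ : 0 < t₀) (hbt₀ : b * t₀ ≤ 1)
    (hCt₀ : 2 * C * t₀ ≤ 1) (ht₀₁ : t₀ < t₁) (ht₀τ : t₀ < τ (1 / 4)) :
    ∃ A ≥ 0, ∀ x : 𝔼, 0 < τ (‖x‖ ^ 2) → τ (‖x‖ ^ 2) < t₀ →
      U (τ (‖x‖ ^ 2)) ≤ u x + A * barrier b (τ (‖x‖ ^ 2)) := by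
  have hb0 : 0 < b := by rw [hb]; positivity
  have hC := h.rate_pos
  have hτc := h.continuous_norm_sq
  obtain ⟨B, hB⟩ := hu.exists_bound_of_radialTime h ht₀
  obtain ⟨A, hA, hAB⟩ := exists_le_mul_barrier hb0 ht₀ (U (t₀ / 2) + B)
  refine ⟨A, hA, fun x hx hxt => ?_⟩
  have hσ : ∀ σ > 0, 4 * C * σ < 1 → (1 + 2 * C * σ) * t₀ + σ < t₁ →
      U ((1 + 2 * C * σ) * τ (‖x‖ ^ 2) + σ) ≤ u x + A * barrier b (τ (‖x‖ ^ 2)) := by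
    intro σ hσ hσC hσt
    set κ := 1 + 2 * C * σ with hκ
    have hκ1 : 1 ≤ κ := by
      have : 0 ≤ 2 * C * σ := by positivity
      linarith
    have hmem : ∀ t, 0 ≤ t → t ≤ t₀ → κ * t + σ ∈ Ioo 0 t₁ := fun t ht ht' =>
      ⟨by positivity, by nlinarith⟩
    have hκc : Continuous fun x : 𝔼 => κ * τ (‖x‖ ^ 2) + σ :=
      (continuous_const.mul hτc).add continuous_const
    set Ω : Set 𝔼 := {x | 0 < τ (‖x‖ ^ 2) ∧ τ (‖x‖ ^ 2) < t₀} with hΩ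
    have hΩo : IsOpen Ω :=
      (isOpen_lt continuous_const hτc).inter (isOpen_lt hτc continuous_const)
    have hΩq : ∀ y ∈ Ω, ‖y‖ ^ 2 ∈ Ioo (1 / 4 : ℝ) 1 := fun y hy =>
      h.norm_sq_mem hy.1 (hy.2.trans ht₀τ)
    have hΩ1 : ∀ y ∈ Ω, ‖y‖ < 1 := fun y hy => h.norm_lt_one hy.1
    refine h.le_add_barrier hN hk hb hfk (Ω := Ω)
      (v := fun y => U (κ * τ (‖y‖ ^ 2) + σ)) hΩo hΩq
      (fun y hy => (mul_le_mul_of_nonneg_left hy.2.le hb0.le).trans hbt₀)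
      (fun y hy => (hU.lapl_rescale hN h hf κ σ (hΩq y hy) (hmem _ hy.1.le hy.2.le)).1)
      (fun y hy => hu.contDiffAt (hΩ1 y hy)) (fun y hy => ?_)
      (fun y hy => (hu.2.1 y (by simpa using hΩ1 y hy)).le) hA ?_ x ⟨hx, hxt⟩
    · rw [(hU.lapl_rescale hN h hf κ σ (hΩq y hy) (hmem _ hy.1.le hy.2.le)).2,
        le_div_iff₀ (h.pos.trans_le (h.le_coeff _)), mul_comm (f _)]
      refine mul_le_mul_of_nonneg_right ?_ (hfpos _ (hU.lt _ (hmem _ hy.1.le hy.2.le)))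
      exact h.le_sq_mul_coeff hσ.le hσC.le hy.1.le
        ((mul_le_mul_of_nonneg_left hy.2.le (by positivity)).trans hCt₀)
    · intro x₀ hx₀ hx₀Ω
      have h1 : 0 ≤ τ (‖x₀‖ ^ 2) :=
        closure_lt_subset_le continuous_const hτc (closure_mono (fun y hy => hy.1) hx₀)
      have h2 : τ (‖x₀‖ ^ 2) ≤ t₀ :=
        closure_lt_subset_le hτc continuous_const (closure_mono (fun y hy => hy.2) hx₀)
      rcases h2.lt_or_eq with h2 | h2
      · have h3 : τ (‖x₀‖ ^ 2) = 0 := le_antisymm (not_lt.1 fun h3 => hx₀Ω ⟨h3, h2⟩) h1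
        have hn : ‖x₀‖ = 1 := by
          have := h.strictAnti.injective (h3.trans h.map_one.symm)
          exact (sq_eq_sq₀ (norm_nonneg _) zero_le_one).1 (by rw [this, one_pow])
        have hUc : ContinuousAt (fun y : 𝔼 => U (κ * τ (‖y‖ ^ 2) + σ)) x₀ :=
          ContinuousAt.comp (g := U) (f := fun y : 𝔼 => κ * τ (‖y‖ ^ 2) + σ)
            (hU.hasDerivAt _ (hmem _ h1 h2.le)).continuousAt hκc.continuousAt
        filter_upwards [(hUc.eventually (gt_mem_nhds (lt_add_one _))).filter_mono
          nhdsWithin_le_nhds, (hu.eventually_gt hn (U (κ * τ (‖x₀‖ ^ 2) + σ) + 1)).filter_mono nhdsWithin_le_nhds,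
          self_mem_nhdsWithin] with y h4 h5 h6
        have h7 := mul_nonneg hA (barrier_nonneg hb0.le h6.1.le)
        have h8 := h5 (by simpa using hΩ1 y h6)
        linarith
      · have hev : ∀ᶠ y in 𝓝[Ω] x₀, t₀ / 2 < τ (‖y‖ ^ 2) :=
          (hτc.continuousAt.eventually (lt_mem_nhds
            (by show t₀ / 2 < τ (‖x₀‖ ^ 2); rw [h2]; linarith))).filter_mono
            nhdsWithin_le_nhds
        filter_upwards [hev, self_mem_nhdsWithin] with y h4 h5
        have h6 := (abs_le.1 (hB y h4.le h5.2.le)).1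
        have h7 := hAB _ h4.le
        have h8 := hU.antitoneOn ⟨half_pos ht₀, by linarith⟩ (hmem _ h5.1.le h5.2.le)
          (by nlinarith [h5.1] : t₀ / 2 ≤ κ * τ (‖y‖ ^ 2) + σ)
        linarith
  have hlim0 : Tendsto (fun σ : ℝ => (1 + 2 * C * σ) * τ (‖x‖ ^ 2) + σ) (𝓝[>] 0)
      (𝓝 (τ (‖x‖ ^ 2))) := by
    have : Continuous fun σ : ℝ => (1 + 2 * C * σ) * τ (‖x‖ ^ 2) + σ := by fun_prop
    have h1 := this.tendsto 0
    simp only [mul_zero, add_zero, one_mul] at h1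
    exact h1.mono_left nhdsWithin_le_nhds
  have hUc : ContinuousAt U (τ (‖x‖ ^ 2)) := (hU.hasDerivAt _ ⟨hx, hxt.trans ht₀₁⟩).continuousAt
  refine le_of_tendsto (hUc.tendsto.comp hlim0) ?_
  have hsmall : ∀ᶠ σ in 𝓝[>] (0 : ℝ), 4 * C * σ < 1 := by
    have : Continuous fun σ : ℝ => 4 * C * σ := by fun_prop
    exact (this.continuousAt.eventually (gt_mem_nhds (by simp))).filter_mono nhdsWithin_le_nhds
  have hsmall' : ∀ᶠ σ in 𝓝[>] (0 : ℝ), (1 + 2 * C * σ) * t₀ + σ < t₁ := by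
    have : Continuous fun σ : ℝ => (1 + 2 * C * σ) * t₀ + σ := by fun_prop
    exact (this.continuousAt.eventually (gt_mem_nhds (by simpa using ht₀₁))).filter_mono
      nhdsWithin_le_nhds
  filter_upwards [self_mem_nhdsWithin, hsmall, hsmall'] with σ h1 h2 h3 using hσ σ h1 h2 h3

lemma IsLargeSolution.almostRadiallyMonotone (hN : 1 ≤ N) {f : ℝ → ℝ} {u : 𝔼 → ℝ}
    (hf : Continuous f) (hu : IsLargeSolution f u) {τ g : ℝ → ℝ} {g₀ C : ℝ}
    (h : IsRadialTime N τ g g₀ C) {k : ℝ} (hk : 0 ≤ k)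
    (hfk : ∀ s t, s ≤ t → f s - f t ≤ k * (t - s)) {U U₁ : ℝ → ℝ} {a t₁ : ℝ}
    (hfpos : ∀ t, a < t → 0 ≤ f t) (hU : IsBlowUpSolution f g U U₁ a t₁) :
    AlmostRadiallyMonotone u := by
  obtain ⟨b, hb⟩ : ∃ b, b = 3 * (k + 1) := ⟨_, rfl⟩
  have hb0 : 0 < b := by rw [hb]; positivity
  have hC := h.rate_pos
  have hτ4 : 0 < τ (1 / 4) := h.map_one ▸ h.strictAnti (by norm_num)
  obtain ⟨t₀, ht₀, hbt₀, hCt₀, ht₀₁, ht₀τ⟩ :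
      ∃ t₀ > 0, b * t₀ ≤ 1 ∧ 2 * C * t₀ ≤ 1 ∧ t₀ < t₁ ∧ t₀ < τ (1 / 4) := by
    have hev : ∀ c : ℝ, ∀ᶠ t in 𝓝[>] (0 : ℝ), c * t < 1 := fun c => by
      have : Continuous fun t : ℝ => c * t := by fun_prop
      exact (this.continuousAt.eventually (gt_mem_nhds (by simp))).filter_mono nhdsWithin_le_nhds
    have e1 : ∀ᶠ t in 𝓝[>] (0 : ℝ), t ∈ Ioo 0 t₁ := Ioo_mem_nhdsGT hU.pos
    have e2 : ∀ᶠ t in 𝓝[>] (0 : ℝ), t ∈ Ioo 0 (τ (1 / 4)) := Ioo_mem_nhdsGT hτ4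
    obtain ⟨t, h1, h2, h3, h4⟩ := ((hev b).and ((hev (2 * C)).and (e1.and e2))).exists
    exact ⟨t, h3.1, h1.le, h2.le, h3.2, h4.2⟩
  obtain ⟨A, hA, hup⟩ := hu.le_blowUpSolution_add_barrier hN hf h hk hb hfk hfpos hU ht₀ hbt₀ hCt₀
    ht₀₁ ht₀τ
  obtain ⟨A', hA', hlow⟩ := hu.blowUpSolution_le_add_barrier hN hf h hk hb hfk hfpos hU ht₀ hbt₀
    hCt₀ ht₀₁ ht₀τ
  intro ε hε
  have hr : Continuous fun r : ℝ => τ (r ^ 2) := h.continuous.comp (by fun_prop)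
  have hbc : Continuous fun r : ℝ => (A + A') * barrier b (τ (r ^ 2)) :=
    continuous_const.mul ((contDiff_barrier b).continuous.comp hr)
  have hev : ∀ᶠ r in 𝓝 (1 : ℝ), τ (r ^ 2) < t₀ ∧ (A + A') * barrier b (τ (r ^ 2)) < ε := by
    refine (hr.continuousAt.eventually (gt_mem_nhds ?_)).and
      (hbc.continuousAt.eventually (gt_mem_nhds ?_))
    · simpa [h.map_one] using ht₀
    · simpa [h.map_one, barrier_zero] using hε
  obtain ⟨d, hd, hball⟩ := Metric.eventually_nhds_iff.1 hev
  refine ⟨1 - d, by linarith, fun x hx y hy hyd hxy => ?_⟩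
  have hx1 : ‖x‖ < 1 := by simpa using hx
  have hy1 : ‖y‖ < 1 := by simpa using hy
  obtain ⟨h1, h2⟩ := hball (y := ‖y‖) (by rw [Real.dist_eq, abs_sub_lt_iff]; constructor <;> linarith)
  have hτpos : ∀ z : 𝔼, ‖z‖ < 1 → 0 < τ (‖z‖ ^ 2) := fun z hz => by
    rw [← h.map_one]
    exact h.strictAnti (by nlinarith [norm_nonneg z])
  have hτle : τ (‖x‖ ^ 2) ≤ τ (‖y‖ ^ 2) :=
    h.strictAnti.antitone (pow_le_pow_left₀ (norm_nonneg _) hxy 2)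
  have h3 := hup y (hτpos y hy1) h1
  have h4 := hlow x (hτpos x hx1) (hτle.trans_lt h1)
  have h5 := hU.antitoneOn ⟨hτpos x hx1, (hτle.trans_lt h1).trans ht₀₁⟩
    ⟨hτpos y hy1, h1.trans ht₀₁⟩ hτle
  have h6 := mul_le_mul_of_nonneg_left (barrier_mono hb0.le hτle) hA'
  linarith

end BoundaryComparison

theorem stmt4 {N : ℕ} (hN : 1 ≤ N)
    (f : ℝ → ℝ) (hf : ContDiff ℝ 1 f)
    (a : ℝ) (ha : 0 < f a) (hfpos : ∀ t, a < t → 0 ≤ f t)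
    (F : ℝ → ℝ) (hF : ∀ t, F t = ∫ s in a..t, f s)
    (hKO : ∃ M, a < M ∧ IntegrableOn (fun t => 1 / Real.sqrt (F t)) (Ici M))
    (f' : ℝ → ℝ) (K : ℝ) (hf'mono : Monotone f') (hpert : ∀ t, f t = f' t - K * t)
    (u : EuclideanSpace ℝ (Fin N) → ℝ) (hu : IsLargeSolution f u) :
    (∃ w : ℝ → ℝ, ∀ x ∈ ball (0 : EuclideanSpace ℝ (Fin N)) 1, u x = w ‖x‖) ∧
    ∀ x ∈ ball (0 : EuclideanSpace ℝ (Fin N)) 1, x ≠ 0 →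
      0 < fderiv ℝ u x (‖x‖⁻¹ • x) := by
  obtain ⟨M, haM, hM⟩ := hKO
  have hfc := hf.continuous
  have hFpos : ∀ t, a < t → 0 < ∫ s in a..t, f s := fun t ht =>
    intervalIntegral.integral_pos ht hfc.continuousOn (fun s hs => hfpos s hs.1)
      ⟨a, left_mem_Icc.2 ht.le, ha⟩
  have hfk : ∀ s t, s ≤ t → f s - f t ≤ max K 0 * (t - s) := fun s t hst => by
    have h1 := hf'mono hst
    have h2 := mul_le_mul_of_nonneg_right (le_max_left K 0) (sub_nonneg.2 hst)
    rw [hpert, hpert]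
    linarith
  obtain ⟨τ, g, g₀, C, h⟩ := exists_isRadialTime hN
  obtain ⟨t₁, ht₁, U, U₁, hU, hanti, hlim⟩ := exists_blowup_solution hfc haM hfpos hFpos
    (by simpa only [hF] using hM) h.coeff_antitone h.coeff_continuous h.pos h.le_coeff
  have hblow : IsBlowUpSolution f g U U₁ a t₁ :=
    ⟨ht₁, fun t ht => (hU t ht).1, fun t ht => (hU t ht).2.1, fun t ht => (hU t ht).2.2,
      hanti, hlim⟩
  exact hu.symmetry_of_almostRadiallyMonotone hN hf
    (hu.almostRadiallyMonotone hN hfc h (le_max_right K 0) hfk hfpos hblow) (le_max_right K 0) hfk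
end

section
/- Let N ≥ 1 and let f be continuous satisfying (P) and (KO). Then there exist U₀ ∈ ℝ (with U₀ > a) and ρ ∈ (0,1) with the following property: setting v₀(u) = √(2F(u)) for u ∈ [U₀,∞), there exists exactly one continuous function v : [U₀,∞) → ℝ satisfying |v(u) − v₀(u)| ≤ ρ·v₀(u) for all u ≥ U₀ (in particular v > 0 and ∫_t^{+∞} ds/v(s) converges for each t ≥ U₀) and solving the integral equation v(u) = √( 2·( F(u) − (N−1)·∫_{U₀}^u v(t) / (1 − ∫_t^{+∞} ds/v(s)) dt ) ) for all u ≥ U₀. -/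
open MeasureTheory Filter Metric Set

theorem continuousOn_integral_Ici {h : ℝ → ℝ} {U : ℝ} (hh : ContinuousOn h (Ici U)) :
    ContinuousOn (fun u => ∫ t in U..u, h t) (Ici U) := by
  have hc : Continuous fun t => h (max U t) :=
    hh.comp_continuous (by fun_prop) fun t => le_max_left U t
  refine (intervalIntegral.continuous_primitive
    (fun b c => hc.intervalIntegrable (μ := volume) b c) U).continuousOn.congr fun u hu => ?_
  refine intervalIntegral.integral_congr fun t ht => ?_
  rw [uIcc_of_le hu] at ht
  simp [max_eq_right ht.1]

theorem intervalIntegrable_of_continuousOn_Ici {h : ℝ → ℝ} {U u : ℝ}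
    (hh : ContinuousOn h (Ici U)) (hu : U ≤ u) : IntervalIntegrable h volume U u :=
  (hh.mono (by rw [uIcc_of_le hu]; exact Icc_subset_Ici_self)).intervalIntegrable

/-- A positive nondecreasing weight on `[U, ∞)` whose inverse has integral at most `δ`. -/
structure IsKellerWeight (m : ℝ → ℝ) (U δ : ℝ) : Prop where
  continuousOn : ContinuousOn m (Ici U)
  pos : ∀ u ∈ Ici U, 0 < m u
  mono : MonotoneOn m (Ici U)
  integrableOn : IntegrableOn (fun s => (m s)⁻¹) (Ioi U)
  integral_le : ∫ s in Ioi U, (m s)⁻¹ ≤ δ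

/-- Continuous functions on `[U, ∞)` within relative distance `1 / 2` of the weight `m`. -/
structure IsNearWeight (m : ℝ → ℝ) (U : ℝ) (v : ℝ → ℝ) : Prop where
  continuousOn : ContinuousOn v (Ici U)
  lower : ∀ u ∈ Ici U, m u / 2 ≤ v u
  upper : ∀ u ∈ Ici U, v u ≤ 3 / 2 * m u

/-- The integrand `v / (1 - ∫_t^∞ 1 / v)` of the radial integral equation. -/
noncomputable def radialDensity (v : ℝ → ℝ) (t : ℝ) : ℝ := v t / (1 - ∫ s in Ioi t, (v s)⁻¹)

/-- The right-hand side of the radial integral equation. -/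
noncomputable def radialOperator (K : ℝ) (m : ℝ → ℝ) (U : ℝ) (v : ℝ → ℝ) (u : ℝ) : ℝ :=
  Real.sqrt (m u ^ 2 - 2 * K * ∫ t in U..u, radialDensity v t)

namespace IsKellerWeight

variable {m v w : ℝ → ℝ} {U δ K d : ℝ}

theorem integral_inv_Ioi_le (hm : IsKellerWeight m U δ) {t : ℝ} (ht : U ≤ t) :
    ∫ s in Ioi t, (m s)⁻¹ ≤ δ := by
  refine le_trans (setIntegral_mono_set hm.integrableOn ?_
    (Ioi_subset_Ioi ht).eventuallyLE) hm.integral_le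
  filter_upwards [ae_restrict_mem measurableSet_Ioi] with s hs
  exact inv_nonneg.2 (hm.pos s (Ioi_subset_Ici_self hs)).le

theorem integral_inv_le (hm : IsKellerWeight m U δ) {u : ℝ} (hu : U ≤ u) :
    ∫ s in U..u, (m s)⁻¹ ≤ δ := by
  rw [← intervalIntegral.integral_Ioi_sub_Ioi hm.integrableOn hu]
  have : 0 ≤ ∫ s in Ioi u, (m s)⁻¹ := setIntegral_nonneg measurableSet_Ioi fun s hs =>
    inv_nonneg.2 (hm.pos s (hu.trans (le_of_lt hs))).le
  linarith [hm.integral_le]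

theorem integral_le_sq_mul (hm : IsKellerWeight m U δ) {u : ℝ} (hu : U ≤ u) :
    ∫ s in U..u, m s ≤ m u ^ 2 * δ := by
  have hc : ContinuousOn (fun s => (m s)⁻¹) (Ici U) :=
    hm.continuousOn.inv₀ fun s hs => (hm.pos s hs).ne'
  calc ∫ s in U..u, m s ≤ ∫ s in U..u, m u ^ 2 * (m s)⁻¹ := by
        refine intervalIntegral.integral_mono_on hu
          (intervalIntegrable_of_continuousOn_Ici hm.continuousOn hu)
          ((intervalIntegrable_of_continuousOn_Ici hc hu).const_mul _) fun s hs => ?_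
        have h0 := hm.pos s hs.1
        have h1 := hm.mono (show s ∈ Ici U from hs.1) (show u ∈ Ici U from hu) hs.2
        rw [← div_eq_mul_inv, le_div_iff₀ h0]
        nlinarith
    _ = m u ^ 2 * ∫ s in U..u, (m s)⁻¹ := intervalIntegral.integral_const_mul _ _
    _ ≤ m u ^ 2 * δ := mul_le_mul_of_nonneg_left (hm.integral_inv_le hu) (sq_nonneg _)

theorem near_pos (hm : IsKellerWeight m U δ) (hv : IsNearWeight m U v) {u : ℝ} (hu : U ≤ u) :
    0 < v u := by
  linarith [hm.pos u hu, hv.lower u hu]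

theorem near_inv_le (hm : IsKellerWeight m U δ) (hv : IsNearWeight m U v) {u : ℝ} (hu : U ≤ u) :
    (v u)⁻¹ ≤ 2 * (m u)⁻¹ := by
  have h0 := hm.pos u hu
  rw [← div_eq_mul_inv, le_div_iff₀ h0, inv_mul_le_iff₀ (hm.near_pos hv hu)]
  linarith [hv.lower u hu]

theorem near_continuousOn_inv (hm : IsKellerWeight m U δ) (hv : IsNearWeight m U v) :
    ContinuousOn (fun s => (v s)⁻¹) (Ici U) :=
  hv.continuousOn.inv₀ fun _ hs => (hm.near_pos hv hs).ne'

theorem near_integrableOn (hm : IsKellerWeight m U δ) (hv : IsNearWeight m U v) {t : ℝ}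
    (ht : U ≤ t) : IntegrableOn (fun s => (v s)⁻¹) (Ioi t) := by
  refine IntegrableOn.mono_set ?_ (Ioi_subset_Ioi ht)
  refine Integrable.mono' (hm.integrableOn.const_mul 2)
    (((hm.near_continuousOn_inv hv).mono Ioi_subset_Ici_self).aestronglyMeasurable
      measurableSet_Ioi) ?_
  filter_upwards [ae_restrict_mem measurableSet_Ioi] with s hs
  rw [Real.norm_eq_abs, abs_of_pos (inv_pos.2 (hm.near_pos hv (le_of_lt hs)))]
  exact hm.near_inv_le hv (le_of_lt hs)

theorem near_tail_le (hm : IsKellerWeight m U δ) (hv : IsNearWeight m U v) {t : ℝ} (ht : U ≤ t) :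
    ∫ s in Ioi t, (v s)⁻¹ ≤ 2 * δ := by
  calc ∫ s in Ioi t, (v s)⁻¹ ≤ ∫ s in Ioi t, 2 * (m s)⁻¹ :=
        setIntegral_mono_on (hm.near_integrableOn hv ht)
          ((hm.integrableOn.mono_set (Ioi_subset_Ioi ht)).const_mul 2) measurableSet_Ioi
          fun s hs => hm.near_inv_le hv (ht.trans (le_of_lt hs))
    _ = 2 * ∫ s in Ioi t, (m s)⁻¹ := integral_const_mul _ _
    _ ≤ 2 * δ := by linarith [hm.integral_inv_Ioi_le ht]

theorem near_tail_nonneg (hm : IsKellerWeight m U δ) (hv : IsNearWeight m U v) {t : ℝ}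
    (ht : U ≤ t) : 0 ≤ ∫ s in Ioi t, (v s)⁻¹ :=
  setIntegral_nonneg measurableSet_Ioi fun _ hs =>
    (inv_pos.2 (hm.near_pos hv (ht.trans (le_of_lt hs)))).le

theorem continuousOn_near_tail (hm : IsKellerWeight m U δ) (hv : IsNearWeight m U v) :
    ContinuousOn (fun t => ∫ s in Ioi t, (v s)⁻¹) (Ici U) := by
  refine (continuousOn_const.sub
    (continuousOn_integral_Ici (hm.near_continuousOn_inv hv))).congr
    (f := fun t => (∫ s in Ioi U, (v s)⁻¹) - ∫ s in U..t, (v s)⁻¹) fun t ht => ?_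
  have := intervalIntegral.integral_Ioi_sub_Ioi (hm.near_integrableOn hv le_rfl) ht
  simp only
  linarith

theorem abs_inv_sub_inv_le (hm : IsKellerWeight m U δ) (hv : IsNearWeight m U v)
    (hw : IsNearWeight m U w) {u : ℝ} (hu : U ≤ u) (hd : |v u - w u| ≤ d * m u) :
    |(v u)⁻¹ - (w u)⁻¹| ≤ 4 * d * (m u)⁻¹ := by
  have hm0 := hm.pos u hu
  have hv0 := hm.near_pos hv hu
  have hw0 := hm.near_pos hw hu
  have hv1 := hv.lower u hu
  have hw1 := hw.lower u hu
  have hd0 : 0 ≤ d := nonneg_of_mul_nonneg_left ((abs_nonneg _).trans hd) hm0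
  have hmul : m u / 2 * (m u / 2) ≤ v u * w u := mul_le_mul hv1 hw1 (by positivity) hv0.le
  rw [inv_sub_inv hv0.ne' hw0.ne', abs_div, abs_sub_comm, abs_of_pos (mul_pos hv0 hw0),
    div_le_iff₀ (mul_pos hv0 hw0)]
  refine hd.trans ?_
  have h4 : 4 * d * (m u)⁻¹ * (m u / 2 * (m u / 2)) = d * m u := by field_simp; ring
  rw [← h4]
  exact mul_le_mul_of_nonneg_left hmul (by positivity)

theorem abs_tail_sub_tail_le (hm : IsKellerWeight m U δ) (hv : IsNearWeight m U v)
    (hw : IsNearWeight m U w) (hd0 : 0 ≤ d) (hd : ∀ u ∈ Ici U, |v u - w u| ≤ d * m u)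
    {t : ℝ} (ht : U ≤ t) :
    |(∫ s in Ioi t, (v s)⁻¹) - ∫ s in Ioi t, (w s)⁻¹| ≤ 4 * d * δ := by
  rw [← integral_sub (hm.near_integrableOn hv ht) (hm.near_integrableOn hw ht), ← Real.norm_eq_abs]
  calc ‖∫ s in Ioi t, ((v s)⁻¹ - (w s)⁻¹)‖ ≤ ∫ s in Ioi t, 4 * d * (m s)⁻¹ := by
        refine norm_integral_le_of_norm_le
          ((hm.integrableOn.mono_set (Ioi_subset_Ioi ht)).const_mul _) ?_
        filter_upwards [ae_restrict_mem measurableSet_Ioi] with s hs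
        have hs' : U ≤ s := ht.trans (le_of_lt hs)
        exact hm.abs_inv_sub_inv_le hv hw hs' (hd s hs')
    _ = 4 * d * ∫ s in Ioi t, (m s)⁻¹ := integral_const_mul _ _
    _ ≤ 4 * d * δ := mul_le_mul_of_nonneg_left (hm.integral_inv_Ioi_le ht) (by positivity)

theorem continuousOn_radialDensity (hm : IsKellerWeight m U δ) (hv : IsNearWeight m U v)
    (hδ : δ ≤ 1 / 4) : ContinuousOn (radialDensity v) (Ici U) :=
  hv.continuousOn.div (continuousOn_const.sub (hm.continuousOn_near_tail hv)) fun t ht => by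
    have := hm.near_tail_le hv ht
    linarith

theorem radialDensity_nonneg (hm : IsKellerWeight m U δ) (hv : IsNearWeight m U v)
    (hδ : δ ≤ 1 / 4) {t : ℝ} (ht : U ≤ t) : 0 ≤ radialDensity v t :=
  div_nonneg (hm.near_pos hv ht).le (by linarith [hm.near_tail_le hv ht])

theorem radialDensity_le (hm : IsKellerWeight m U δ) (hv : IsNearWeight m U v)
    (hδ : δ ≤ 1 / 4) {t : ℝ} (ht : U ≤ t) : radialDensity v t ≤ 3 * m t := by
  have h1 := hm.near_tail_le hv ht
  have h2 := hv.upper t ht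
  have h3 := hm.pos t ht
  rw [radialDensity, div_le_iff₀ (by linarith)]
  nlinarith

theorem abs_radialDensity_sub_le (hm : IsKellerWeight m U δ) (hv : IsNearWeight m U v)
    (hw : IsNearWeight m U w) (hδ : δ ≤ 1 / 4) (hd0 : 0 ≤ d)
    (hd : ∀ u ∈ Ici U, |v u - w u| ≤ d * m u) {t : ℝ} (ht : U ≤ t) :
    |radialDensity v t - radialDensity w t| ≤ 8 * d * m t := by
  have hm0 := hm.pos t ht
  have hv1 := hm.near_tail_le hv ht
  have hw1 := hm.near_tail_le hw ht
  have hI := hm.abs_tail_sub_tail_le hv hw hd0 hd ht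
  have hG := hm.radialDensity_le hw hδ ht
  have hG0 := hm.radialDensity_nonneg hw hδ ht
  have hdt := hd t ht
  unfold radialDensity at *
  generalize (∫ s in Ioi t, (v s)⁻¹) = I at *
  generalize (∫ s in Ioi t, (w s)⁻¹) = J at *
  have hI0 : 0 < 1 - I := by linarith
  have hJ0 : 0 < 1 - J := by linarith
  have key : v t / (1 - I) - w t / (1 - J) =
      ((v t - w t) + w t / (1 - J) * (I - J)) / (1 - I) := by
    field_simp
    ring
  rw [key, abs_div, abs_of_pos hI0, div_le_iff₀ hI0]
  have h1 : |w t / (1 - J) * (I - J)| ≤ 3 * m t * d := by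
    rw [abs_mul, abs_of_nonneg hG0]
    refine mul_le_mul hG (hI.trans ?_) (abs_nonneg _) (by positivity)
    nlinarith
  have h2 := abs_add_le (v t - w t) (w t / (1 - J) * (I - J))
  nlinarith [mul_nonneg hd0 hm0.le]

theorem integral_radialDensity_bounds (hm : IsKellerWeight m U δ) (hv : IsNearWeight m U v)
    (hδ : δ ≤ 1 / 4) {u : ℝ} (hu : U ≤ u) :
    0 ≤ ∫ t in U..u, radialDensity v t ∧ ∫ t in U..u, radialDensity v t ≤ 3 * δ * m u ^ 2 := by
  refine ⟨intervalIntegral.integral_nonneg hu fun t ht => hm.radialDensity_nonneg hv hδ ht.1, ?_⟩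
  calc ∫ t in U..u, radialDensity v t ≤ ∫ t in U..u, 3 * m t :=
        intervalIntegral.integral_mono_on hu
          (intervalIntegrable_of_continuousOn_Ici (hm.continuousOn_radialDensity hv hδ) hu)
          ((intervalIntegrable_of_continuousOn_Ici hm.continuousOn hu).const_mul _)
          fun t ht => hm.radialDensity_le hv hδ ht.1
    _ = 3 * ∫ t in U..u, m t := intervalIntegral.integral_const_mul _ _
    _ ≤ 3 * δ * m u ^ 2 := by linarith [hm.integral_le_sq_mul hu]

theorem abs_integral_radialDensity_sub_le (hm : IsKellerWeight m U δ) (hv : IsNearWeight m U v)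
    (hw : IsNearWeight m U w) (hδ : δ ≤ 1 / 4) (hd0 : 0 ≤ d)
    (hd : ∀ u ∈ Ici U, |v u - w u| ≤ d * m u) {u : ℝ} (hu : U ≤ u) :
    |(∫ t in U..u, radialDensity v t) - ∫ t in U..u, radialDensity w t| ≤
      8 * d * (m u ^ 2 * δ) := by
  rw [← intervalIntegral.integral_sub
    (intervalIntegrable_of_continuousOn_Ici (hm.continuousOn_radialDensity hv hδ) hu)
    (intervalIntegrable_of_continuousOn_Ici (hm.continuousOn_radialDensity hw hδ) hu),
    ← Real.norm_eq_abs]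
  calc ‖∫ t in U..u, (radialDensity v t - radialDensity w t)‖ ≤ ∫ t in U..u, 8 * d * m t := by
        refine intervalIntegral.norm_integral_le_of_norm_le hu (ae_of_all _ fun t ht => ?_)
          ((intervalIntegrable_of_continuousOn_Ici hm.continuousOn hu).const_mul _)
        exact hm.abs_radialDensity_sub_le hv hw hδ hd0 hd ht.1.le
    _ = 8 * d * ∫ t in U..u, m t := intervalIntegral.integral_const_mul _ _
    _ ≤ 8 * d * (m u ^ 2 * δ) :=
        mul_le_mul_of_nonneg_left (hm.integral_le_sq_mul hu) (by positivity)

theorem radialOperator_near (hm : IsKellerWeight m U δ) (hv : IsNearWeight m U v)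
    (hδ : δ ≤ 1 / 4) (hK : 0 ≤ K) (hKδ : K * δ ≤ 1 / 32) :
    IsNearWeight m U (radialOperator K m U v) where
  continuousOn := ((hm.continuousOn.pow 2).sub (continuousOn_const.mul
    (continuousOn_integral_Ici (hm.continuousOn_radialDensity hv hδ)))).sqrt
  lower u hu := by
    have hm0 := hm.pos u hu
    obtain ⟨-, h⟩ := hm.integral_radialDensity_bounds hv hδ hu
    have h' := mul_le_mul_of_nonneg_left h hK
    exact Real.le_sqrt_of_sq_le (by nlinarith [sq_nonneg (m u)])
  upper u hu := by
    have hm0 := hm.pos u hu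
    obtain ⟨h, -⟩ := hm.integral_radialDensity_bounds hv hδ hu
    refine (Real.sqrt_le_sqrt (?_ : _ ≤ m u ^ 2)).trans ?_
    · nlinarith [mul_nonneg hK h]
    · rw [Real.sqrt_sq hm0.le]
      linarith

theorem abs_radialOperator_sub_le (hm : IsKellerWeight m U δ) (hv : IsNearWeight m U v)
    (hw : IsNearWeight m U w) (hδ : δ ≤ 1 / 4) (hK : 0 ≤ K) (hKδ : K * δ ≤ 1 / 32) (hd0 : 0 ≤ d)
    (hd : ∀ u ∈ Ici U, |v u - w u| ≤ d * m u) {u : ℝ} (hu : U ≤ u) :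
    |radialOperator K m U v u - radialOperator K m U w u| ≤ d / 2 * m u := by
  have hm0 := hm.pos u hu
  have hv1 := (hm.radialOperator_near hv hδ hK hKδ).lower u hu
  have hw1 := (hm.radialOperator_near hw hδ hK hKδ).lower u hu
  have hI := hm.abs_integral_radialDensity_sub_le hv hw hδ hd0 hd hu
  have hsq : ∀ {z}, IsNearWeight m U z → radialOperator K m U z u ^ 2 =
      m u ^ 2 - 2 * K * ∫ t in U..u, radialDensity z t := fun {z} hz => by
    refine Real.sq_sqrt ?_
    have h' := mul_le_mul_of_nonneg_left (hm.integral_radialDensity_bounds hz hδ hu).2 hK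
    nlinarith [sq_nonneg (m u)]
  have hv2 := hsq hv
  have hw2 := hsq hw
  set x := radialOperator K m U v u
  set y := radialOperator K m U w u
  have hxy : |x - y| * (x + y) ≤ d / 2 * m u * m u := by
    rw [← abs_of_nonneg (show 0 ≤ x + y by linarith), ← abs_mul,
      show (x - y) * (x + y) = -(2 * K * ((∫ t in U..u, radialDensity v t) -
        ∫ t in U..u, radialDensity w t)) by linear_combination hv2 - hw2,
      abs_neg, abs_mul, abs_of_nonneg (by positivity)]
    refine (mul_le_mul_of_nonneg_left hI (by positivity)).trans ?_
    have := mul_le_mul_of_nonneg_left hKδ (show 0 ≤ 16 * d * m u ^ 2 by positivity)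
    linarith
  have : |x - y| * m u ≤ |x - y| * (x + y) :=
    mul_le_mul_of_nonneg_left (by linarith) (abs_nonneg _)
  exact le_of_mul_le_mul_right (this.trans hxy) hm0

theorem eqOn_of_fixed (hm : IsKellerWeight m U δ) (hv : IsNearWeight m U v)
    (hw : IsNearWeight m U w) (hδ : δ ≤ 1 / 4) (hK : 0 ≤ K) (hKδ : K * δ ≤ 1 / 32)
    (hvf : ∀ u ∈ Ici U, v u = radialOperator K m U v u)
    (hwf : ∀ u ∈ Ici U, w u = radialOperator K m U w u) : EqOn v w (Ici U) := by
  have h : ∀ n : ℕ, ∀ u ∈ Ici U, |v u - w u| ≤ (1 / 2) ^ n * m u := by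
    intro n
    induction n with
    | zero =>
      intro u hu
      rw [abs_le]
      constructor <;> linarith [hv.lower u hu, hv.upper u hu, hw.lower u hu, hw.upper u hu]
    | succ n ih =>
      intro u hu
      rw [hvf u hu, hwf u hu, pow_succ, mul_one_div]
      exact hm.abs_radialOperator_sub_le hv hw hδ hK hKδ (by positivity) ih hu
  intro u hu
  have hlim : Tendsto (fun n : ℕ => (1 / 2 : ℝ) ^ n * m u) atTop (nhds 0) := by
    simpa using (tendsto_pow_atTop_nhds_zero_of_lt_one (r := (1 / 2 : ℝ)) (by norm_num)
      (by norm_num)).mul_const (m u)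
  have := ge_of_tendsto' hlim fun n => h n u hu
  exact sub_eq_zero.1 (abs_nonpos_iff.1 this)

open BoundedContinuousFunction in
theorem exists_fixed (hm : IsKellerWeight m U δ) (hδ : δ ≤ 1 / 4) (hK : 0 ≤ K)
    (hKδ : K * δ ≤ 1 / 32) :
    ∃ v, IsNearWeight m U v ∧ ∀ u ∈ Ici U, v u = radialOperator K m U v u := by
  let X : Set (ℝ →ᵇ ℝ) := {g | ∀ u, g u ∈ Icc (1 / 2) (3 / 2)}
  have hX : IsClosed X := by
    simp only [X, ofPred_forall]
    exact isClosed_iInter fun u =>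
      isClosed_Icc.preimage (continuous_eval_const (x := u))
  have : CompleteSpace X := hX.completeSpace_coe
  have : Nonempty X := ⟨⟨BoundedContinuousFunction.const ℝ 1, fun u => by norm_num⟩⟩
  have hnear : ∀ g : X, IsNearWeight m U fun u => g.1 u * m u := fun g =>
    { continuousOn := g.1.continuous.continuousOn.mul hm.continuousOn
      lower := fun u hu => by nlinarith [(g.2 u).1, hm.pos u hu]
      upper := fun u hu => mul_le_mul_of_nonneg_right (g.2 u).2 (hm.pos u hu).le }
  have hT : ∀ g : X, ∃ h : X, ∀ u, h.1 u =
      radialOperator K m U (fun u => g.1 u * m u) (max U u) / m (max U u) := by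
    intro g
    have hn := hm.radialOperator_near (hnear g) hδ hK hKδ
    have hb : ∀ u, radialOperator K m U (fun u => g.1 u * m u) (max U u) / m (max U u) ∈
        Icc (1 / 2 : ℝ) (3 / 2) := fun u => by
      have hu : max U u ∈ Ici U := le_max_left U u
      have h0 := hm.pos _ hu
      rw [mem_Icc, le_div_iff₀ h0, div_le_iff₀ h0]
      exact ⟨by linarith [hn.lower _ hu], hn.upper _ hu⟩
    have hc : Continuous fun u =>
        radialOperator K m U (fun u => g.1 u * m u) (max U u) / m (max U u) :=
      (hn.continuousOn.div hm.continuousOn fun u hu => (hm.pos u hu).ne').comp_continuous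
        (continuous_const.max continuous_id) fun u => le_max_left U u
    exact ⟨⟨BoundedContinuousFunction.mkOfBound ⟨_, hc⟩ 1 fun x y => by
      rw [Real.dist_eq, abs_le]
      have hx := hb x
      have hy := hb y
      constructor <;> simp only [ContinuousMap.coe_mk] <;> linarith [hx.1, hx.2, hy.1, hy.2],
      hb⟩, fun u => rfl⟩
  choose T hT using hT
  have hcontr : ContractingWith (1 / 2) T := by
    refine ⟨by rw [← NNReal.coe_lt_coe]; norm_num, LipschitzWith.of_dist_le_mul fun g h => ?_⟩
    refine (BoundedContinuousFunction.dist_le (by positivity)).2 fun u => ?_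
    have hu : max U u ∈ Ici U := le_max_left U u
    have h0 := hm.pos _ hu
    rw [hT, hT, Real.dist_eq, ← sub_div, abs_div, abs_of_pos h0, div_le_iff₀ h0]
    have := hm.abs_radialOperator_sub_le (hnear g) (hnear h) hδ hK hKδ
      (dist_nonneg (x := g.1) (y := h.1)) (fun s hs => by
        rw [← sub_mul, abs_mul, abs_of_pos (hm.pos s hs)]
        exact mul_le_mul_of_nonneg_right ((Real.dist_eq _ _).symm.trans_le
          (BoundedContinuousFunction.dist_coe_le_dist (f := g.1) (g := h.1) s))
          (hm.pos s hs).le) hu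
    rw [Subtype.dist_eq]
    push_cast
    linarith
  obtain ⟨g, hg⟩ : ∃ g, T g = g := ⟨_, hcontr.fixedPoint_isFixedPt⟩
  refine ⟨_, hnear g, fun u hu => ?_⟩
  have := hT g u
  rw [hg, max_eq_right hu] at this
  rw [eq_div_iff (hm.pos u hu).ne'] at this
  exact this

end IsKellerWeight

theorem exists_isKellerWeight_sqrt {f F : ℝ → ℝ} {a M δ : ℝ} (hf : Continuous f) (ha : 0 < f a)
    (hfpos : ∀ t, a < t → 0 ≤ f t) (hF : ∀ t, F t = ∫ s in a..t, f s) (hM : a < M)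
    (hint : IntegrableOn (fun t => 1 / Real.sqrt (F t)) (Ici M)) (hδ : 0 < δ) :
    ∃ U, a < U ∧ (∀ u ∈ Ici U, 0 < F u) ∧ IsKellerWeight (fun u => Real.sqrt (2 * F u)) U δ := by
  have hFpos : ∀ t, a < t → 0 < F t := fun t ht => by
    rw [hF]
    exact intervalIntegral.integral_pos ht hf.continuousOn (fun s hs => hfpos s hs.1)
      ⟨a, left_mem_Icc.2 ht.le, ha⟩
  have hFcont : Continuous F := by
    rw [funext hF]
    exact intervalIntegral.continuous_primitive (fun b c => hf.intervalIntegrable b c) a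
  have hFmono : ∀ s t, a < s → s ≤ t → F s ≤ F t := fun s t hs hst => by
    have h := intervalIntegral.integral_interval_sub_left
      (hf.intervalIntegrable (μ := volume) a t) (hf.intervalIntegrable a s)
    have h' : 0 ≤ ∫ x in s..t, f x :=
      intervalIntegral.integral_nonneg hst fun x hx => hfpos x (hs.trans_le hx.1)
    rw [hF, hF]
    linarith
  have hint' : IntegrableOn (fun t => (Real.sqrt (2 * F t))⁻¹) (Ioi M) := by
    refine IntegrableOn.congr_fun ((hint.mono_set Ioi_subset_Ici_self).const_mul (Real.sqrt 2)⁻¹)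
      (fun t _ => ?_) measurableSet_Ioi
    simp only [one_div]
    rw [Real.sqrt_mul zero_le_two, mul_inv]
  have htail : Tendsto (fun U => ∫ t in Ioi U, (Real.sqrt (2 * F t))⁻¹) atTop (nhds 0) := by
    have h := (intervalIntegral_tendsto_integral_Ioi M hint' tendsto_id).const_sub
      (∫ t in Ioi M, (Real.sqrt (2 * F t))⁻¹)
    rw [sub_self] at h
    refine h.congr' ?_
    filter_upwards [eventually_ge_atTop M] with U hU
    have := intervalIntegral.integral_Ioi_sub_Ioi hint' hU
    simp only [id]
    linarith
  obtain ⟨U, hUδ, hU⟩ := ((htail.eventually_lt_const hδ).and (eventually_ge_atTop M)).exists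
  have haU : a < U := hM.trans_le hU
  refine ⟨U, haU, fun u hu => hFpos u (haU.trans_le hu), ?_, ?_, ?_, ?_, hUδ.le⟩
  · exact (continuous_const.mul hFcont).sqrt.continuousOn
  · exact fun u hu => Real.sqrt_pos.2 (mul_pos two_pos (hFpos u (haU.trans_le hu)))
  · exact fun s hs t _ hst => Real.sqrt_le_sqrt
      (mul_le_mul_of_nonneg_left (hFmono s t (haU.trans_le hs) hst) zero_le_two)
  · exact hint'.mono_set (Ioi_subset_Ioi hU)

theorem stmt5 {N : ℕ} (hN : 1 ≤ N)
    (f : ℝ → ℝ) (hf : Continuous f)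
    (a : ℝ) (ha : 0 < f a) (hfpos : ∀ t, a < t → 0 ≤ f t)
    (F : ℝ → ℝ) (hF : ∀ t, F t = ∫ s in a..t, f s)
    (hKO : ∃ M, a < M ∧ IntegrableOn (fun t => 1 / Real.sqrt (F t)) (Ici M)) :
    ∃ U₀ : ℝ, a < U₀ ∧ ∃ ρ ∈ Ioo (0 : ℝ) 1,
      (fun v₀ : ℝ → ℝ =>
        (fun P : (ℝ → ℝ) → Prop => (∃ v, P v) ∧ ∀ v w, P v → P w → EqOn v w (Ici U₀))
          (fun v : ℝ → ℝ =>
            ContinuousOn v (Ici U₀) ∧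
            (∀ u ∈ Ici U₀, |v u - v₀ u| ≤ ρ * v₀ u) ∧
            (∀ u ∈ Ici U₀, 0 < v u) ∧
            (∀ t ∈ Ici U₀, IntegrableOn (fun s => (v s)⁻¹) (Ioi t)) ∧
            ∀ u ∈ Ici U₀, v u = Real.sqrt (2 * (F u -
              ((N : ℝ) - 1) * ∫ t in U₀..u, v t / (1 - ∫ s in Ioi t, (v s)⁻¹)))))
        (fun u => Real.sqrt (2 * F u)) := by
  obtain ⟨M, hM, hint⟩ := hKO
  have hN' : (1 : ℝ) ≤ N := by exact_mod_cast hN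
  have hK : 0 ≤ (N : ℝ) - 1 := by linarith
  obtain ⟨U, haU, hFpos, hm⟩ := exists_isKellerWeight_sqrt (δ := 1 / (32 * N)) hf ha hfpos hF hM
    hint (by positivity)
  have hδ : 1 / (32 * (N : ℝ)) ≤ 1 / 4 := one_div_le_one_div_of_le (by norm_num) (by linarith)
  have hKδ : ((N : ℝ) - 1) * (1 / (32 * (N : ℝ))) ≤ 1 / 32 := by
    rw [mul_one_div, div_le_div_iff₀ (by positivity) (by norm_num)]
    linarith
  have hop : ∀ v : ℝ → ℝ, ∀ u ∈ Ici U,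
      radialOperator ((N : ℝ) - 1) (fun u => Real.sqrt (2 * F u)) U v u =
        Real.sqrt (2 * (F u -
          ((N : ℝ) - 1) * ∫ t in U..u, v t / (1 - ∫ s in Ioi t, (v s)⁻¹))) := fun v u hu => by
    simp only [radialOperator, radialDensity]
    rw [Real.sq_sqrt (mul_pos two_pos (hFpos u hu)).le]
    congr 1
    ring
  refine ⟨U, haU, 1 / 2, by norm_num, ?_, ?_⟩
  · obtain ⟨v, hv, hvf⟩ := hm.exists_fixed hδ hK hKδ
    refine ⟨v, hv.continuousOn, fun u hu => ?_, fun u hu => hm.near_pos hv hu,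
      fun t ht => hm.near_integrableOn hv ht, fun u hu => (hvf u hu).trans (hop v u hu)⟩
    have h1 := hv.lower u hu
    have h2 := hv.upper u hu
    rw [abs_le]
    constructor <;> linarith
  · have hnear : ∀ v : ℝ → ℝ, ContinuousOn v (Ici U) →
        (∀ u ∈ Ici U, |v u - Real.sqrt (2 * F u)| ≤ 1 / 2 * Real.sqrt (2 * F u)) →
        IsNearWeight (fun u => Real.sqrt (2 * F u)) U v := fun v hc hb =>
      { continuousOn := hc
        lower := fun u hu => by linarith [(abs_le.1 (hb u hu)).1]
        upper := fun u hu => by linarith [(abs_le.1 (hb u hu)).2] }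
    rintro v w ⟨hvc, hvb, -, -, hvf⟩ ⟨hwc, hwb, -, -, hwf⟩
    exact hm.eqOn_of_fixed (hnear v hvc hvb) (hnear w hwc hwb) hδ hK hKδ
      (fun u hu => (hvf u hu).trans (hop v u hu).symm)
      (fun u hu => (hwf u hu).trans (hop w u hu).symm)
end
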